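/- Let b be a nonextreme function in the unit ball of H^∞, let Y be the restriction of the shift operator S = T_z to the de Branges–Rovnyak space H(b), let z₀ ∈ ∂𝔻, and let λ ∈ ∂𝔻 be such that the measure μ_λ is absolutely continuous. If z̄₀ is an eigenvalue of Y*, then the eigenspace ker(Y* − z̄₀) is one dimensional and is spanned by the boundary kernel function k_{z₀}^b(z) = (1 − conj(b(z₀)) b(z))/(1 − z̄₀ z), where b(z₀) is the nontangential limit of b at z₀. -/

import Mathlib

open Complex MeasureTheory Filter Set

noncomputable section

/-! ### Basic framework: Hardy spaces on the unit disk via boundary values -/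

/-- The open unit disk in the complex plane. -/
def unitDisk : Set ℂ := Metric.ball 0 1

/-- The point `e^{iθ}` of the unit circle. -/
def uc (θ : ℝ) : ℂ := Complex.exp ((θ : ℂ) * Complex.I)

/-- Lebesgue measure on the parameter interval `(0, 2π]` of the unit circle. -/
def bMeasure : Measure ℝ := volume.restrict (Set.Ioc 0 (2 * Real.pi))

/-- Radial limit of `f` at the boundary point `w` (`|w| = 1`). -/
def radLim (f : ℂ → ℂ) (w : ℂ) : ℂ :=
  limUnder (nhdsWithin (1 : ℝ) (Set.Iio 1)) fun r : ℝ => f ((r : ℂ) * w)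

/-- The boundary value function of `f` on the unit circle. -/
def bdry (f : ℂ → ℂ) (θ : ℝ) : ℂ := radLim f (uc θ)

/-- Membership in the Hardy space `H²` of the unit disk. -/
def MemH2 (f : ℂ → ℂ) : Prop :=
  DifferentiableOn ℂ f unitDisk ∧
    ∃ C : ℝ, ∀ r ∈ Set.Ico (0 : ℝ) 1,
      (∫ θ in (0:ℝ)..(2 * Real.pi), ‖f ((r : ℂ) * uc θ)‖ ^ 2) ≤ C

/-- Membership in the Hardy space `H¹` of the unit disk. -/
def MemH1 (f : ℂ → ℂ) : Prop :=
  DifferentiableOn ℂ f unitDisk ∧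
    ∃ C : ℝ, ∀ r ∈ Set.Ico (0 : ℝ) 1,
      (∫ θ in (0:ℝ)..(2 * Real.pi), ‖f ((r : ℂ) * uc θ)‖) ≤ C

/-- Membership in `H^∞` (bounded holomorphic functions on the disk). -/
def MemHinf (f : ℂ → ℂ) : Prop :=
  DifferentiableOn ℂ f unitDisk ∧ ∃ C : ℝ, ∀ z ∈ unitDisk, ‖f z‖ ≤ C

/-- The `H²` (normalized boundary `L²`) inner product `⟨f, g⟩`. -/
def bInner (f g : ℂ → ℂ) : ℂ :=
  (1 / (2 * (Real.pi : ℂ))) *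
    ∫ θ in (0:ℝ)..(2 * Real.pi), bdry f θ * (starRingEnd ℂ) (bdry g θ)

/-- The squared `H²` norm, computed on the boundary. -/
def bNormSq (f : ℂ → ℂ) : ℝ :=
  (1 / (2 * Real.pi)) * ∫ θ in (0:ℝ)..(2 * Real.pi), ‖bdry f θ‖ ^ 2

/-- `f` is an inner function. -/
def IsInner (f : ℂ → ℂ) : Prop :=
  DifferentiableOn ℂ f unitDisk ∧ (∀ z ∈ unitDisk, ‖f z‖ ≤ 1) ∧
    ∀ᵐ θ ∂bMeasure, ‖bdry f θ‖ = 1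

/-- `f` is an outer function: it is, up to a unimodular constant, the Herglotz
exponential of the Poisson integral of `log |f*|`. -/
def IsOuter (f : ℂ → ℂ) : Prop :=
  DifferentiableOn ℂ f unitDisk ∧ ∃ c : ℂ, ‖c‖ = 1 ∧ ∀ z ∈ unitDisk,
    f z = c * Complex.exp ((1 / (2 * (Real.pi : ℂ))) *
      ∫ θ in (0:ℝ)..(2 * Real.pi),
        ((uc θ + z) / (uc θ - z)) * ((Real.log ‖bdry f θ‖ : ℝ) : ℂ))

/-- `b` is a nonextreme point of the closed unit ball of `H^∞`:
`log (1 - |b|)` is integrable on the circle. -/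
def Nonextreme (b : ℂ → ℂ) : Prop :=
  DifferentiableOn ℂ b unitDisk ∧ (∀ z ∈ unitDisk, ‖b z‖ ≤ 1) ∧
    Integrable (fun θ => Real.log (1 - ‖bdry b θ‖)) bMeasure

/-- `(b, a)` is a pair: `b` nonextreme, `a` outer, `|a|² + |b|² = 1` a.e. on the circle. -/
def IsPair (b a : ℂ → ℂ) : Prop :=
  Nonextreme b ∧ IsOuter a ∧
    ∀ᵐ θ ∂bMeasure, ‖bdry a θ‖ ^ 2 + ‖bdry b θ‖ ^ 2 = 1

/-- `(b, a)` is the pair associated with the outer function `f` of unit `H²` norm: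
`f = a / (1 - b)`. -/
def PairAssoc (f b a : ℂ → ℂ) : Prop :=
  IsOuter f ∧ MemH2 f ∧ bNormSq f = 1 ∧ IsPair b a ∧
    ∀ z ∈ unitDisk, f z = a z / (1 - b z)

/-- The Herglotz measure `μ_λ` of `(1 + λ̄b)/(1 − λ̄b)` is absolutely continuous:
the Herglotz representation holds with density `|a/(1 − λ̄b)|²` and no singular part. -/
def HerglotzAC (b a : ℂ → ℂ) (lam : ℂ) : Prop :=
  ∀ z ∈ unitDisk,
    (1 + (starRingEnd ℂ) lam * b z) / (1 - (starRingEnd ℂ) lam * b z) =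
      (1 / (2 * (Real.pi : ℂ))) *
        (∫ θ in (0:ℝ)..(2 * Real.pi),
          ((1 + (uc θ)⁻¹ * z) / (1 - (uc θ)⁻¹ * z)) *
            ((‖bdry (fun w => a w / (1 - (starRingEnd ℂ) lam * b w)) θ‖ ^ 2 : ℝ) : ℂ)) +
      Complex.I *
        ((((1 + (starRingEnd ℂ) lam * b 0) / (1 - (starRingEnd ℂ) lam * b 0)).im : ℝ) : ℂ)

/-- The pair `(b, a)` is special: the Herglotz measure of `(1+b)/(1−b)` is
absolutely continuous. -/
def SpecialPair (b a : ℂ → ℂ) : Prop := IsPair b a ∧ HerglotzAC b a 1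

/-- `F ∈ H¹` is rigid: the only functions of `H¹` with the same argument a.e. on the
circle are the positive scalar multiples of `F`. -/
def Rigid (F : ℂ → ℂ) : Prop :=
  MemH1 F ∧ ∀ G : ℂ → ℂ, MemH1 G →
    (∀ᵐ θ ∂bMeasure, ∃ t : ℝ, 0 < t ∧ bdry G θ = (t : ℂ) * bdry F θ) →
    ∃ c : ℝ, 0 < c ∧ ∀ z ∈ unitDisk, G z = (c : ℂ) * F z

/-- The Riesz (analytic) projection `P₊` of a boundary function, realized through the
Szegő integral: `(P₊u)(z) = (1/2π) ∫ u(θ) (1 − z e^{-iθ})⁻¹ dθ`. -/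
def szProj (u : ℝ → ℂ) : ℂ → ℂ := fun z =>
  (1 / (2 * (Real.pi : ℂ))) *
    ∫ θ in (0:ℝ)..(2 * Real.pi), u θ * (1 - z * (uc θ)⁻¹)⁻¹

/-- The Toeplitz operator with boundary symbol `φ`: `T_φ h = P₊(φ · h*)`. -/
def toeplitz (φ : ℝ → ℂ) (h : ℂ → ℂ) : ℂ → ℂ := szProj fun θ => φ θ * bdry h θ

/-- The kernel of the Toeplitz operator `T_φ`, as a subset of `H²`. -/
def toeplitzKer (φ : ℝ → ℂ) : Set (ℂ → ℂ) :=
  {h | MemH2 h ∧ ∀ z ∈ unitDisk, toeplitz φ h z = 0}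

/-- The boundary symbol `ḡ` of a function `g` on the disk. -/
def conjBdry (g : ℂ → ℂ) : ℝ → ℂ := fun θ => (starRingEnd ℂ) (bdry g θ)

/-- The boundary symbol `ḡ/g`. -/
def symbQuot (g : ℂ → ℂ) : ℝ → ℂ := fun θ => (starRingEnd ℂ) (bdry g θ) / bdry g θ

/-- The boundary symbol `Ī f̄ / f`. -/
def symbIf (I f : ℂ → ℂ) : ℝ → ℂ :=
  fun θ => (starRingEnd ℂ) (bdry I θ) * (starRingEnd ℂ) (bdry f θ) / bdry f θ

/-- The model space `K_I = H² ⊖ I H² = ker T_Ī` of an inner function `I`. -/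
def modelSpace (I : ℂ → ℂ) : Set (ℂ → ℂ) := toeplitzKer (conjBdry I)

/-- The set `f·K_I`. -/
def fModel (f I : ℂ → ℂ) : Set (ℂ → ℂ) :=
  {g | ∃ h ∈ modelSpace I, ∀ z ∈ unitDisk, g z = f z * h z}

/-- The orthogonal complement `ker T_{Ī f̄/f} ⊖ f·K_I` of `f·K_I` in the kernel of
`T_{Ī f̄/f}`, with respect to the `H²` inner product. -/
def kerPerp (I f : ℂ → ℂ) : Set (ℂ → ℂ) :=
  {h | h ∈ toeplitzKer (symbIf I f) ∧ ∀ g ∈ fModel f I, bInner h g = 0}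

/-- `M(a) = T_a H² = a·H²` (for `a ∈ H^∞`), the range of `T_a`, as a set. -/
def rangeMa (a : ℂ → ℂ) : Set (ℂ → ℂ) :=
  {g | ∃ h, MemH2 h ∧ ∀ z ∈ unitDisk, g z = a z * h z}

/-- Membership in the de Branges–Rovnyak space `H(b)` for nonextreme `b` with
pair `(b, a)`:  `h ∈ H(b)` iff `h ∈ H²` and `T_b̄ h = T_ā h⁺` for some `h⁺ ∈ H²`
(Sarason's characterization). -/
def MemHb (b a h : ℂ → ℂ) : Prop :=
  MemH2 h ∧ ∃ h' : ℂ → ℂ, MemH2 h' ∧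
    ∀ z ∈ unitDisk, toeplitz (conjBdry b) h z = toeplitz (conjBdry a) h' z

/-- The function `h⁺ ∈ H²` with `T_b̄ h = T_ā h⁺` (unique when it exists, since `a`
is outer). -/
def plusFun (b a h : ℂ → ℂ) : ℂ → ℂ :=
  Classical.epsilon fun h' : ℂ → ℂ => MemH2 h' ∧
    ∀ z ∈ unitDisk, toeplitz (conjBdry b) h z = toeplitz (conjBdry a) h' z

/-- The inner product of `H(b)`: `⟨h, g⟩_b = ⟨h, g⟩₂ + ⟨h⁺, g⁺⟩₂`. -/
def hbInner (b a h g : ℂ → ℂ) : ℂ :=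
  bInner h g + bInner (plusFun b a h) (plusFun b a g)

/-- The squared norm of `H(b)`. -/
def hbNormSq (b a h : ℂ → ℂ) : ℝ := (hbInner b a h h).re

/-- The closure of a set `S` in the norm of `H(b)`. -/
def hbClosure (b a : ℂ → ℂ) (S : Set (ℂ → ℂ)) : Set (ℂ → ℂ) :=
  {h | MemHb b a h ∧ ∀ ε : ℝ, 0 < ε → ∃ g ∈ S,
    hbNormSq b a (fun z => h z - g z) < ε}

/-- The orthogonal complement of `S` in `H(b)`. -/
def hbPerp (b a : ℂ → ℂ) (S : Set (ℂ → ℂ)) : Set (ℂ → ℂ) :=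
  {h | MemHb b a h ∧ ∀ g ∈ S, hbInner b a h g = 0}

/-- A set of functions on the disk is a `k`-dimensional linear subspace. -/
def HasDimOn (S : Set (ℂ → ℂ)) (k : ℕ) : Prop :=
  ∃ g : Fin k → (ℂ → ℂ), (∀ j, g j ∈ S) ∧
    (∀ c : Fin k → ℂ, (∀ z ∈ unitDisk, (∑ j, c j * g j z) = 0) → c = 0) ∧
    ∀ h ∈ S, ∃ c : Fin k → ℂ, ∀ z ∈ unitDisk, h z = ∑ j, c j * g j z

/-- The Szegő kernel `k_w(z) = (1 - w̄ z)⁻¹` of `H²`. -/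
def szKernel (w z : ℂ) : ℂ := (1 - (starRingEnd ℂ) w * z)⁻¹

/-- The reproducing kernel of `H(b)` at an interior point `w ∈ 𝔻`. -/
def hbKernel (b : ℂ → ℂ) (w z : ℂ) : ℂ :=
  (1 - (starRingEnd ℂ) (b w) * b z) / (1 - (starRingEnd ℂ) w * z)

/-- The boundary kernel of `H(b)` at a boundary point `z₀`, defined through the
nontangential limit `b(z₀) = radLim b z₀`. -/
def hbBoundaryKernel (b : ℂ → ℂ) (z₀ z : ℂ) : ℂ :=
  (1 - (starRingEnd ℂ) (radLim b z₀) * b z) / (1 - (starRingEnd ℂ) z₀ * z)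

/-- `u` is a nontangential approach sequence to the boundary point `z₀`. -/
def NTApproach (u : ℕ → ℂ) (z₀ : ℂ) : Prop :=
  (∀ n, u n ∈ unitDisk) ∧ Filter.Tendsto u Filter.atTop (nhds z₀) ∧
    ∃ M : ℝ, ∀ n, ‖u n - z₀‖ ≤ M * (1 - ‖u n‖)

/-- `b` has an angular derivative in the sense of Carathéodory at `z₀ ∈ ∂𝔻`. -/
def HasADC (b : ℂ → ℂ) (z₀ : ℂ) : Prop :=
  ‖radLim b z₀‖ = 1 ∧ ∃ L : ℂ, ∀ u : ℕ → ℂ, NTApproach u z₀ →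
    Filter.Tendsto (fun n => b (u n)) Filter.atTop (nhds (radLim b z₀)) ∧
    Filter.Tendsto (fun n => (b (u n) - radLim b z₀) / (u n - z₀)) Filter.atTop (nhds L)


/-- Weak formulation of `Y* h = conj z₀ · h` in `H(b)`, where `Y = S|_{H(b)}` is the
restricted shift: `⟨h, Y g⟩_b = conj z₀ ⟨h, g⟩_b` for all `g ∈ H(b)`. -/
def YstarEigen (b a : ℂ → ℂ) (z₀ : ℂ) (h : ℂ → ℂ) : Prop :=
  MemHb b a h ∧ ∀ g : ℂ → ℂ, MemHb b a g →
    hbInner b a h (fun z => z * g z) = (starRingEnd ℂ) z₀ * hbInner b a h g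

/-! ### Fatou's theorem for Poisson integrals -/

/-- A bump of height `1 / δ` and decay `δ / |t - x₀|²` is integrated against a measure of small
density at `x₀`. -/
theorem lintegral_bump_le (ν : Measure ℝ) (x₀ s₀ ε δ : ℝ) (hs₀ : 0 < s₀) (hε : 0 ≤ ε) (hδ : 0 < δ)
    (hν : ∀ s, 0 < s → s ≤ s₀ → ν (Metric.closedBall x₀ s) ≤ ENNReal.ofReal (ε * s))
    (f : ℝ → ℝ) (hf : Measurable f) (hf0 : ∀ t, 0 ≤ f t) (hf1 : ∀ t, f t ≤ 1 / δ)
    (hf2 : ∀ t, f t * (t - x₀) ^ 2 ≤ δ) :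
    ∫⁻ t, ENNReal.ofReal (f t) ∂ν ≤
      ν univ * ENNReal.ofReal (δ / s₀ ^ 2) + ENNReal.ofReal (2 * ε) := by
  rw [lintegral_eq_lintegral_meas_le ν (ae_of_all _ hf0) hf.aemeasurable]
  have hsplit : ∀ y ∈ Ioi (0 : ℝ), ν {t | y ≤ f t} ≤
      (Ioc 0 (δ / s₀ ^ 2)).indicator (fun _ => ν univ) y +
      (Ioc 0 (1 / δ)).indicator
        (fun y => ENNReal.ofReal (ε * Real.sqrt δ * y ^ (-(1 / 2) : ℝ))) y := by
    intro y hy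
    have hy : 0 < y := hy
    by_cases h1 : y ≤ δ / s₀ ^ 2
    · rw [indicator_of_mem (show y ∈ Ioc 0 (δ / s₀ ^ 2) from ⟨hy, h1⟩)]
      exact (measure_mono (subset_univ _)).trans le_self_add
    by_cases h2 : y ≤ 1 / δ
    · rw [indicator_of_mem (show y ∈ Ioc 0 (1 / δ) from ⟨hy, h2⟩)]
      refine le_trans ?_ le_add_self
      push Not at h1
      have hsub : {t | y ≤ f t} ⊆ Metric.closedBall x₀ (Real.sqrt (δ / y)) := by
        intro t ht
        rw [Metric.mem_closedBall, Real.dist_eq]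
        apply Real.abs_le_sqrt
        rw [le_div_iff₀ hy]
        have : y ≤ f t := ht
        nlinarith [hf2 t, sq_nonneg (t - x₀)]
      refine (measure_mono hsub).trans ((hν _ (Real.sqrt_pos.2 (by positivity)) ?_).trans_eq ?_)
      · rw [Real.sqrt_le_left hs₀.le, div_le_iff₀ hy]
        rw [div_lt_iff₀ (by positivity)] at h1
        linarith
      · rw [Real.sqrt_div hδ.le, Real.rpow_neg hy.le, ← Real.sqrt_eq_rpow, mul_assoc, div_eq_mul_inv]
    · have : {t | y ≤ f t} = ∅ := by
        ext t
        simp only [mem_ofPred_eq, mem_empty_iff_false, iff_false, not_le]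
        push Not at h2
        exact (hf1 t).trans_lt h2
      rw [this, measure_empty]
      exact zero_le
  refine (setLIntegral_mono' measurableSet_Ioi hsplit).trans ?_
  refine (setLIntegral_le_lintegral _ _).trans ?_
  rw [lintegral_add_left (measurable_const.indicator measurableSet_Ioc),
    lintegral_indicator measurableSet_Ioc, lintegral_indicator measurableSet_Ioc]
  refine add_le_add ?_ ?_
  · simp [Real.volume_Ioc]
  · have hint : IntervalIntegrable (fun y : ℝ => ε * Real.sqrt δ * y ^ (-(1 / 2) : ℝ)) volume
        0 (1 / δ) :=
      (intervalIntegral.intervalIntegrable_rpow' (by norm_num)).const_mul _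
    rw [← ofReal_integral_eq_lintegral_ofReal
      ((intervalIntegrable_iff_integrableOn_Ioc_of_le (by positivity)).1 hint)]
    · apply ENNReal.ofReal_le_ofReal
      rw [← intervalIntegral.integral_of_le (by positivity), intervalIntegral.integral_const_mul,
        integral_rpow (Or.inl (by norm_num))]
      have : (-(1 / 2) + 1 : ℝ) = 1 / 2 := by norm_num
      rw [this, Real.zero_rpow (by norm_num), ← Real.sqrt_eq_rpow, sub_zero, mul_div_assoc', 
        mul_assoc, ← Real.sqrt_mul hδ.le, mul_one_div_cancel hδ.ne', Real.sqrt_one]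
      linarith
    · filter_upwards [ae_restrict_mem measurableSet_Ioc] with y hy
      have := hy.1
      positivity

theorem norm_uc (θ : ℝ) : ‖uc θ‖ = 1 := norm_exp_ofReal_mul_I θ

@[fun_prop]
theorem continuous_uc : Continuous uc := by unfold uc; fun_prop

theorem norm_uc_sub_uc_le (t θ : ℝ) : ‖uc t - uc θ‖ ≤ |t - θ| := by
  have : uc t - uc θ = uc θ * (exp (I * ((t - θ : ℝ) : ℂ)) - 1) := by
    unfold uc
    rw [mul_sub, ← exp_add]
    congr 2
    · push_cast; ring
    · ring
  rw [this, norm_mul, norm_uc, one_mul]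
  exact Real.norm_exp_I_mul_ofReal_sub_one_le

/-- The circle parametrisation is bi-Lipschitz around an interior parameter. -/
theorem exists_mul_le_norm_uc_sub_uc {θ : ℝ} (hθ : θ ∈ Ioo 0 (2 * Real.pi)) :
    ∃ c > 0, ∀ t ∈ Icc 0 (2 * Real.pi), c * |t - θ| ≤ ‖uc t - uc θ‖ := by
  set m := max θ (2 * Real.pi - θ) / 2 with hm
  have hm0 : 0 < m := by have := le_max_left θ (2 * Real.pi - θ); have := hθ.1; positivity
  have hmpi : m < Real.pi := by
    have : max θ (2 * Real.pi - θ) < 2 * Real.pi := max_lt hθ.2 (by linarith [hθ.1])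
    rw [hm]; linarith
  have hsin : 0 < Real.sin m := Real.sin_pos_of_pos_of_lt_pi hm0 hmpi
  refine ⟨Real.sin m / m, by positivity, fun t ht => ?_⟩
  have hnorm : ‖uc t - uc θ‖ = 2 * Real.sin (|t - θ| / 2) := by
    have : uc t - uc θ = uc θ * (exp (I * ((t - θ : ℝ) : ℂ)) - 1) := by
      unfold uc
      rw [mul_sub, ← exp_add]
      congr 2
      · push_cast; ring
      · ring
    rw [this, norm_mul, norm_uc, one_mul, Complex.norm_exp_I_mul_ofReal_sub_one, norm_mul]
    have h1 : |t - θ| / 2 = |(t - θ) / 2| := by rw [abs_div, abs_two]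
    rw [h1, Real.norm_eq_abs, Real.norm_eq_abs, abs_two, 
      Real.abs_sin_eq_sin_abs_of_abs_le_pi]
    rw [← h1]
    have : |t - θ| ≤ 2 * Real.pi := abs_le.2 ⟨by linarith [ht.1, hθ.2], by linarith [ht.2, hθ.1]⟩
    linarith
  have hle : |t - θ| / 2 ≤ m := by
    rw [hm]
    have : |t - θ| ≤ max θ (2 * Real.pi - θ) := by
      rw [abs_le]
      exact ⟨by linarith [ht.1, le_max_left θ (2 * Real.pi - θ)],
        by linarith [ht.2, le_max_right θ (2 * Real.pi - θ)]⟩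
    linarith
  have hconc := strictConcaveOn_sin_Icc.concaveOn.2
    (show (0 : ℝ) ∈ Icc 0 Real.pi from ⟨le_rfl, Real.pi_pos.le⟩)
    (show m ∈ Icc 0 Real.pi from ⟨hm0.le, hmpi.le⟩)
    (show 0 ≤ 1 - |t - θ| / 2 / m by rw [sub_nonneg, div_le_one hm0]; exact hle)
    (show 0 ≤ |t - θ| / 2 / m by positivity) (by ring)
  simp only [smul_eq_mul, mul_zero, Real.sin_zero, zero_add] at hconc
  rw [div_mul_cancel₀ _ hm0.ne'] at hconc
  rw [hnorm]
  calc Real.sin m / m * |t - θ| = 2 * (|t - θ| / 2 / m * Real.sin m) := by field_simp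
    _ ≤ _ := by linarith

theorem integral_bMeasure {E : Type*} [NormedAddCommGroup E] [NormedSpace ℝ E] (f : ℝ → E) :
    ∫ θ in (0 : ℝ)..(2 * Real.pi), f θ = ∫ θ, f θ ∂bMeasure :=
  intervalIntegral.integral_of_le Real.two_pi_pos.le

instance : IsFiniteMeasure bMeasure := by unfold bMeasure; infer_instance

theorem bMeasure_real_univ : bMeasure.real univ = 2 * Real.pi := by
  simp [bMeasure, Measure.real, Real.pi_pos.le]

/-- The Poisson kernel of the unit disk. -/
def poisson (z ζ : ℂ) : ℝ := (1 - ‖z‖ ^ 2) / ‖ζ - z‖ ^ 2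

theorem norm_radial {r : ℝ} (hr : 0 ≤ r) (θ : ℝ) : ‖(r : ℂ) * uc θ‖ = r := by
  rw [norm_mul, norm_uc, mul_one, norm_real, Real.norm_of_nonneg hr]

theorem radial_mem {r : ℝ} (hr : 0 ≤ r) (hr1 : r < 1) (θ : ℝ) : (r : ℂ) * uc θ ∈ unitDisk := by
  rw [unitDisk, mem_ball_zero_iff, norm_radial hr]; exact hr1

theorem sub_le_norm_uc_sub (z : ℂ) (t : ℝ) : 1 - ‖z‖ ≤ ‖uc t - z‖ := by
  have := norm_sub_norm_le (uc t) z
  rwa [norm_uc] at this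

theorem uc_sub_ne_zero {z : ℂ} (hz : z ∈ unitDisk) (t : ℝ) : uc t - z ≠ 0 := by
  rw [unitDisk, mem_ball_zero_iff] at hz
  rw [← norm_pos_iff]
  linarith [sub_le_norm_uc_sub z t]

theorem continuous_poisson_uc {z : ℂ} (hz : z ∈ unitDisk) :
    Continuous fun t => poisson z (uc t) := by
  unfold poisson
  refine Continuous.div (by fun_prop) (by fun_prop) fun t => ?_
  have := uc_sub_ne_zero hz t
  positivity

theorem norm_poisson_le {z : ℂ} (hz : z ∈ unitDisk) (t : ℝ) :
    ‖poisson z (uc t)‖ ≤ (1 - ‖z‖ ^ 2) / (1 - ‖z‖) ^ 2 := by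
  have h := uc_sub_ne_zero hz t
  rw [unitDisk, mem_ball_zero_iff] at hz
  have h1 : 0 ≤ 1 - ‖z‖ ^ 2 := by nlinarith [norm_nonneg z]
  unfold poisson
  rw [Real.norm_of_nonneg (by positivity)]
  have h3 : 0 < 1 - ‖z‖ := by linarith
  have := sub_le_norm_uc_sub z t
  gcongr

theorem integrable_bdd_mul {u φ : ℝ → ℂ} (hu : Integrable u bMeasure)
    (hφ : AEStronglyMeasurable φ bMeasure) {C : ℝ} (hC : ∀ t, ‖φ t‖ ≤ C) :
    Integrable (fun t => u t * φ t) bMeasure :=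
  hu.mul_bdd hφ (ae_of_all _ hC)

theorem integrable_poisson_mul {u : ℝ → ℂ} (hu : Integrable u bMeasure) {z : ℂ}
    (hz : z ∈ unitDisk) : Integrable (fun t => u t * (poisson z (uc t) : ℂ)) bMeasure := by
  refine integrable_bdd_mul hu
    (continuous_ofReal.comp (continuous_poisson_uc hz)).aestronglyMeasurable
    (C := (1 - ‖z‖ ^ 2) / (1 - ‖z‖) ^ 2) (fun t => ?_)
  rw [norm_real]
  exact norm_poisson_le hz t

/-- The Poisson kernel along a radius is a bump. -/
theorem poisson_radial_bounds {θ c : ℝ} (hc0 : 0 < c)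
    (hc : ∀ t ∈ Icc 0 (2 * Real.pi), c * |t - θ| ≤ ‖uc t - uc θ‖) {r : ℝ} (hr : 0 ≤ r)
    (hr1 : r < 1) {t : ℝ} (ht : t ∈ Icc 0 (2 * Real.pi)) :
    0 ≤ poisson (r * uc θ) (uc t) ∧ poisson (r * uc θ) (uc t) ≤ 2 / (1 - r) ∧
      poisson (r * uc θ) (uc t) * (t - θ) ^ 2 ≤ 8 / c ^ 2 * (1 - r) := by
  have hz := radial_mem hr hr1 θ
  have hne := uc_sub_ne_zero hz t
  have hD : 0 < ‖uc t - r * uc θ‖ := norm_pos_iff.2 hne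
  have h1 : 1 - r ≤ ‖uc t - r * uc θ‖ := by
    have := sub_le_norm_uc_sub (r * uc θ) t
    rwa [norm_radial hr] at this
  have h2 : ‖uc t - uc θ‖ ≤ 2 * ‖uc t - r * uc θ‖ := by
    have : uc t - uc θ = (uc t - r * uc θ) - ((1 - r : ℝ) : ℂ) * uc θ := by push_cast; ring
    rw [this]
    refine (norm_sub_le _ _).trans ?_
    rw [norm_radial (by linarith)]
    linarith
  have h3 := hc t ht
  unfold poisson
  rw [norm_radial hr]
  have h4 : 0 < 1 - r := by linarith
  refine ⟨div_nonneg (by nlinarith) (by positivity), ?_, ?_⟩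
  · rw [div_le_div_iff₀ (by positivity) h4]
    nlinarith [mul_nonneg h4.le (sub_nonneg.2 h1), mul_nonneg hD.le (sub_nonneg.2 h1)]
  · have h5 : (c * |t - θ|) ^ 2 ≤ 4 * ‖uc t - r * uc θ‖ ^ 2 := by
      have : c * |t - θ| ≤ 2 * ‖uc t - r * uc θ‖ := by linarith
      calc (c * |t - θ|) ^ 2 ≤ (2 * ‖uc t - r * uc θ‖) ^ 2 := by gcongr
        _ = _ := by ring
    rw [mul_pow, sq_abs] at h5
    rw [div_mul_eq_mul_div, div_mul_eq_mul_div, div_le_div_iff₀ (by positivity) (by positivity)]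
    nlinarith [mul_le_mul_of_nonneg_left h5 h4.le, mul_nonneg h4.le (sq_nonneg (t - θ)),
      mul_nonneg (mul_nonneg h4.le hr) (sq_nonneg (t - θ)), mul_nonneg h4.le (sq_nonneg ‖uc t - r * uc θ‖),
      mul_nonneg (mul_nonneg h4.le (sub_nonneg.2 hr1.le)) (mul_nonneg (sq_nonneg c) (sq_nonneg (t - θ)))]

theorem circleAverage_eq (f : ℂ → ℂ) :
    Real.circleAverage f 0 1 = (1 / (2 * (Real.pi : ℂ))) * ∫ θ, f (uc θ) ∂bMeasure := by
  rw [Real.circleAverage_def, integral_bMeasure]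
  simp only [circleMap, zero_add, ofReal_one, one_mul]
  rw [real_smul]
  push_cast
  rw [one_div]
  rfl

theorem integral_poisson {z : ℂ} (hz : z ∈ unitDisk) :
    (1 / (2 * (Real.pi : ℂ))) * ∫ t, (poisson z (uc t) : ℂ) ∂bMeasure = 1 := by
  have := DiffContOnCl.circleAverage_poissonKernel_smul' (f := fun _ : ℂ => (1 : ℂ)) (R := 1)
    diffContOnCl_const hz
  rw [circleAverage_eq] at this
  simpa [poisson, norm_uc] using this

/-- **Fatou's theorem** for Poisson integrals of integrable functions. -/
theorem fatou_poisson {u : ℝ → ℂ} (hu : Integrable u bMeasure) {f : ℂ → ℂ}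
    (hf : ∀ z ∈ unitDisk,
      f z = (1 / (2 * (Real.pi : ℂ))) * ∫ t, u t * (poisson z (uc t) : ℂ) ∂bMeasure) :
    ∀ᵐ θ ∂bMeasure, Tendsto (fun r : ℝ => f ((r : ℂ) * uc θ)) (nhdsWithin 1 (Iio 1))
      (nhds (u θ)) := by
  set w : ℝ → ℂ := (Ioc 0 (2 * Real.pi)).indicator u with hw
  have hwi : Integrable w := (integrable_indicator_iff measurableSet_Ioc).2 hu
  have hleb := IsUnifLocDoublingMeasure.ae_tendsto_average_norm_sub volume hwi.locallyIntegrable 1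
  have hend : ∀ᵐ θ ∂bMeasure, θ ≠ 2 * Real.pi :=
    ae_restrict_of_ae (Measure.ae_ne volume _)
  filter_upwards [ae_restrict_of_ae hleb, hend, ae_restrict_mem measurableSet_Ioc]
    with θ hθ hθ2 hθm
  have hθI : θ ∈ Ioo 0 (2 * Real.pi) := ⟨hθm.1, lt_of_le_of_ne hθm.2 hθ2⟩
  obtain ⟨c, hc0, hc⟩ := exists_mul_le_norm_uc_sub_uc hθI
  have hwθ : w θ = u θ := indicator_of_mem hθm _
  have hav := hθ (fun _ => θ) (fun s : ℝ => s) (l := nhdsWithin 0 (Ioi 0)) tendsto_id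
    (eventually_nhdsWithin_of_forall fun s hs => by
      rw [one_mul]; exact Metric.mem_closedBall_self (le_of_lt hs))
  rw [hwθ] at hav
  set ν : Measure ℝ := bMeasure.withDensity fun t => ‖u t - u θ‖ₑ with hνdef
  have hui : Integrable (fun t => u t - u θ) bMeasure := hu.sub (integrable_const _)
  have hνfin : ν univ < ⊤ := by
    rw [hνdef, withDensity_apply _ MeasurableSet.univ, Measure.restrict_univ]
    exact hui.2
  set K := max 2 (8 / c ^ 2) with hK
  have hK0 : 0 < K := lt_max_of_lt_left two_pos
  rw [Metric.tendsto_nhds]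
  intro η hη
  set ε := η / (4 * K) with hε
  have hε0 : 0 < ε := by positivity
  have hsmall : ∃ s₀ > 0, ∀ s, 0 < s → s ≤ s₀ →
      ν (Metric.closedBall θ s) ≤ ENNReal.ofReal (ε * s) := by
    have h1 := hav.eventually (gt_mem_nhds (half_pos hε0))
    rw [eventually_nhdsWithin_iff, Metric.eventually_nhds_iff] at h1
    obtain ⟨d, hd, h1⟩ := h1
    refine ⟨d / 2, half_pos hd, fun s hs hsd => ?_⟩
    have h2 := h1 (y := s) (by rw [Real.dist_eq, sub_zero, abs_of_pos hs]; linarith) hs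
    have hfs : volume (Metric.closedBall θ s) ≠ ⊤ := measure_closedBall_lt_top.ne
    have hint : IntegrableOn (fun t => ‖w t - u θ‖) (Metric.closedBall θ s) :=
      (hwi.integrableOn.sub (integrableOn_const hfs)).norm
    rw [setAverage_eq, smul_eq_mul, measureReal_def, Real.volume_closedBall,
      ENNReal.toReal_ofReal (by linarith), inv_mul_lt_iff₀ (by linarith)] at h2
    rw [hνdef, withDensity_apply _ measurableSet_closedBall]
    calc ∫⁻ t in Metric.closedBall θ s, ‖u t - u θ‖ₑ ∂bMeasure
        = ∫⁻ t in Metric.closedBall θ s ∩ Ioc 0 (2 * Real.pi), ‖w t - u θ‖ₑ := by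
          rw [bMeasure, Measure.restrict_restrict measurableSet_closedBall]
          refine setLIntegral_congr_fun (measurableSet_closedBall.inter measurableSet_Ioc) ?_
          intro t ht
          simp only [hw, indicator_of_mem ht.2]
      _ ≤ ∫⁻ t in Metric.closedBall θ s, ‖w t - u θ‖ₑ := lintegral_mono_set inter_subset_left
      _ = ENNReal.ofReal (∫ t in Metric.closedBall θ s, ‖w t - u θ‖) := by
          rw [ofReal_integral_eq_lintegral_ofReal hint (ae_of_all _ fun _ => norm_nonneg _)]
          simp only [ofReal_norm]
      _ ≤ _ := by apply ENNReal.ofReal_le_ofReal; linarith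
  obtain ⟨s₀, hs₀, hν⟩ := hsmall
  set M := (ν univ).toReal with hM
  have hlim : Tendsto (fun r : ℝ => K * (M * ((1 - r) / s₀ ^ 2) + 2 * ε)) (nhdsWithin 1 (Iio 1))
      (nhds (K * (M * ((1 - 1) / s₀ ^ 2) + 2 * ε))) := by
    apply tendsto_nhdsWithin_of_tendsto_nhds
    apply Continuous.tendsto
    fun_prop
  have hlt : K * (M * ((1 - 1) / s₀ ^ 2) + 2 * ε) < η := by
    have : K * (M * ((1 - 1) / s₀ ^ 2) + 2 * ε) = η / 2 := by
      rw [hε, sub_self, zero_div, mul_zero, zero_add]; field_simp; norm_num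
    linarith
  have hIco : ∀ᶠ r : ℝ in nhdsWithin 1 (Iio 1), 0 ≤ r ∧ r < 1 := by
    filter_upwards [self_mem_nhdsWithin,
      mem_nhdsWithin_of_mem_nhds (Ioi_mem_nhds (zero_lt_one (α := ℝ)))] with r h1 h2
    exact ⟨le_of_lt h2, h1⟩
  filter_upwards [hlim.eventually (gt_mem_nhds hlt), hIco] with r hr1 hr2
  obtain ⟨hr0, hrl⟩ := hr2
  have hz := radial_mem hr0 hrl θ
  have hb := fun t ht => poisson_radial_bounds hc0 hc hr0 hrl (t := t) ht
  refine lt_of_le_of_lt ?_ hr1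
  have hdiff : f (r * uc θ) - u θ = (1 / (2 * (Real.pi : ℂ))) *
      ∫ t, (u t - u θ) * (poisson (r * uc θ) (uc t) : ℂ) ∂bMeasure := by
    simp only [sub_mul]
    rw [integral_sub (integrable_poisson_mul hu hz)
      (integrable_poisson_mul (integrable_const _) hz), mul_sub, ← hf _ hz, integral_const_mul,
      mul_left_comm, integral_poisson hz, mul_one]
  rw [dist_eq_norm, hdiff, norm_mul]
  have hpi : ‖1 / (2 * (Real.pi : ℂ))‖ ≤ 1 := by
    rw [norm_div, norm_one, norm_mul, norm_real, Real.norm_of_nonneg Real.pi_pos.le]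
    simp only [RCLike.norm_ofNat]
    rw [div_le_one (by positivity)]
    linarith [Real.pi_gt_three]
  refine (mul_le_of_le_one_left (norm_nonneg _) hpi).trans ?_
  set g : ℝ → ℝ := (Icc 0 (2 * Real.pi)).indicator fun t => poisson (r * uc θ) (uc t) / K with hg
  have hgK : ∀ t ∈ Icc 0 (2 * Real.pi), poisson (r * uc θ) (uc t) = K * g t := by
    intro t ht
    rw [hg, indicator_of_mem ht]
    field_simp
  have hb' : ∀ t, 0 ≤ g t ∧ g t ≤ 1 / (1 - r) ∧ g t * (t - θ) ^ 2 ≤ 1 - r := by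
    intro t
    have h4 : 0 < 1 - r := by linarith
    by_cases ht : t ∈ Icc 0 (2 * Real.pi)
    · obtain ⟨h1, h2, h3⟩ := hb t ht
      rw [hgK t ht] at h1 h2 h3
      refine ⟨nonneg_of_mul_nonneg_right h1 hK0, ?_, ?_⟩
      · rw [le_div_iff₀ h4] at h2 ⊢
        have : K * (g t * (1 - r)) ≤ K * 1 := by
          calc K * (g t * (1 - r)) = K * g t * (1 - r) := by ring
            _ ≤ 2 := h2
            _ ≤ K * 1 := by rw [mul_one]; exact le_max_left _ _
        exact le_of_mul_le_mul_left this hK0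
      · refine le_of_mul_le_mul_left ?_ hK0
        calc K * (g t * (t - θ) ^ 2) = K * g t * (t - θ) ^ 2 := by ring
          _ ≤ 8 / c ^ 2 * (1 - r) := h3
          _ ≤ K * (1 - r) := by gcongr; exact le_max_right _ _
    · rw [hg, indicator_of_notMem ht]
      exact ⟨le_rfl, by positivity, by rw [zero_mul]; exact h4.le⟩
  have hgm : Measurable g :=
    ((continuous_poisson_uc hz).measurable.div_const K).indicator measurableSet_Icc
  have key := lintegral_bump_le ν θ s₀ ε (1 - r) hs₀ hε0.le (by linarith) hν g hgm
    (fun t => (hb' t).1) (fun t => (hb' t).2.1) (fun t => (hb' t).2.2)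
  rw [hνdef, lintegral_withDensity_eq_lintegral_mul₀ hui.1.enorm
    hgm.ennreal_ofReal.aemeasurable, ← hνdef, ← ENNReal.ofReal_toReal hνfin.ne, ← hM,
    ← ENNReal.ofReal_mul ENNReal.toReal_nonneg, ← ENNReal.ofReal_add (by
      have : 0 < 1 - r := by linarith
      positivity) (by positivity)] at key
  have h4 : 0 < 1 - r := by linarith
  have hfin : ENNReal.ofReal ‖∫ t, (u t - u θ) * (poisson (r * uc θ) (uc t) : ℂ) ∂bMeasure‖ ≤
      ENNReal.ofReal (K * (M * ((1 - r) / s₀ ^ 2) + 2 * ε)) := by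
    rw [ofReal_norm]
    refine (enorm_integral_le_lintegral_enorm _).trans ?_
    rw [ENNReal.ofReal_mul hK0.le]
    refine le_trans (le_of_eq ?_) (mul_le_mul_right key _)
    rw [← lintegral_const_mul'' _ (by
      exact (hui.1.enorm.mul hgm.ennreal_ofReal.aemeasurable))]
    refine setLIntegral_congr_fun measurableSet_Ioc fun t ht => ?_
    have ht' : t ∈ Icc 0 (2 * Real.pi) := ⟨ht.1.le, ht.2⟩
    simp only [Pi.mul_apply]
    rw [enorm_mul, hgK t ht', ← ofReal_norm ((K * g t : ℝ) : ℂ), norm_real,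
      Real.norm_of_nonneg (mul_nonneg hK0.le (hb' t).1), ENNReal.ofReal_mul hK0.le]
    ring
  exact (ENNReal.ofReal_le_ofReal_iff (by positivity)).1 hfin

/-! ### Boundary values of functions in `H²` -/

/-- Bounded families in `L²` of the circle have weak limit points. -/
theorem exists_weak_limit {F : ℝ → ℝ → ℂ} (hF : ∀ r ∈ Ico (0 : ℝ) 1, MemLp (F r) 2 bMeasure)
    {C : ℝ} (hC : ∀ r ∈ Ico (0 : ℝ) 1, ∫ θ, ‖F r θ‖ ^ 2 ∂bMeasure ≤ C) :
    ∃ U : Filter ℝ, U.NeBot ∧ U ≤ nhdsWithin 1 (Iio 1) ∧ ∃ u : ℝ → ℂ, MemLp u 2 bMeasure ∧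
      ∀ v : ℝ → ℂ, MemLp v 2 bMeasure →
        Tendsto (fun r => ∫ θ, F r θ * v θ ∂bMeasure) U (nhds (∫ θ, u θ * v θ ∂bMeasure)) := by
  classical
  let H := Lp ℂ 2 bMeasure
  let x : ℝ → H := fun r => if h : r ∈ Ico (0 : ℝ) 1 then (hF r h).star.toLp else 0
  have hinner : ∀ (p q : ℝ → ℂ) (hp : MemLp p 2 bMeasure) (hq : MemLp q 2 bMeasure),
      inner ℂ (hp.star.toLp) (hq.toLp) = ∫ θ, p θ * q θ ∂bMeasure := by
    intro p q hp hq
    rw [L2.inner_def]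
    refine integral_congr_ae ?_
    filter_upwards [hp.star.coeFn_toLp, hq.coeFn_toLp] with θ h1 h2
    rw [h1, h2]
    simp [mul_comm]
  have hx : ∀ r ∈ Ico (0 : ℝ) 1, ‖x r‖ ≤ Real.sqrt C := by
    intro r hr
    apply Real.le_sqrt_of_sq_le
    have h1 : ((‖x r‖ ^ 2 : ℝ) : ℂ) = ((∫ θ, ‖F r θ‖ ^ 2 ∂bMeasure : ℝ) : ℂ) := by
      have := inner_self_eq_norm_sq_to_K (𝕜 := ℂ) (x r)
      push_cast
      rw [← ofReal_pow]
      simp only [coe_algebraMap, ofReal_pow] at this ⊢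
      rw [← this, ← integral_complex_ofReal]
      simp only [x, dif_pos hr]
      have h2 := hinner _ _ (hF r hr) (hF r hr).star
      rw [h2]
      refine integral_congr_ae (ae_of_all _ fun θ => ?_)
      simp [mul_conj, normSq_eq_norm_sq]
    rw [ofReal_inj.1 h1]
    exact hC r hr
  let T : ℝ → WeakDual ℂ H := fun r => StrongDual.toWeakDual (InnerProductSpace.toDual ℂ H (x r))
  have hcomp := WeakDual.isCompact_closedBall (𝕜 := ℂ) (E := H) 0 (Real.sqrt C)
  let U := Ultrafilter.of (nhdsWithin (1 : ℝ) (Iio 1))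
  have hU : (U : Filter ℝ) ≤ nhdsWithin (1 : ℝ) (Iio 1) := Ultrafilter.of_le _
  have hIco : ∀ᶠ r : ℝ in nhdsWithin 1 (Iio 1), r ∈ Ico (0 : ℝ) 1 := by
    filter_upwards [self_mem_nhdsWithin,
      mem_nhdsWithin_of_mem_nhds (Ioi_mem_nhds (zero_lt_one (α := ℝ)))] with r h1 h2
    exact ⟨le_of_lt h2, h1⟩
  have hmem : ((U.map T : Ultrafilter _) : Filter (WeakDual ℂ H)) ≤
      𝓟 (WeakDual.toStrongDual ⁻¹' Metric.closedBall (0 : StrongDual ℂ H) (Real.sqrt C)) := by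
    rw [le_principal_iff, Ultrafilter.mem_coe, Ultrafilter.mem_map]
    refine hU ?_
    filter_upwards [hIco] with r hr
    rw [mem_preimage, mem_preimage, mem_closedBall_zero_iff]
    exact ((InnerProductSpace.toDual ℂ H).norm_map (x r)).trans_le (hx r hr)
  obtain ⟨L, -, hL⟩ := hcomp.ultrafilter_le_nhds _ hmem
  let y : H := (InnerProductSpace.toDual ℂ H).symm (WeakDual.toStrongDual L)
  refine ⟨U, inferInstance, hU, star (y : ℝ → ℂ), (Lp.memLp y).star, fun v hv => ?_⟩
  have h1 : Tendsto (fun r => T r hv.toLp) U (nhds (L hv.toLp)) :=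
    ((WeakDual.eval_continuous hv.toLp).tendsto L).comp hL
  have h2 : L hv.toLp = ∫ θ, star (y : ℝ → ℂ) θ * v θ ∂bMeasure := by
    have : L hv.toLp = inner ℂ y hv.toLp := by
      rw [InnerProductSpace.toDual_symm_apply]; rfl
    rw [this, L2.inner_def]
    refine integral_congr_ae ?_
    filter_upwards [hv.coeFn_toLp] with θ h2
    rw [h2]
    simp [mul_comm]
  rw [← h2]
  refine h1.congr' ?_
  filter_upwards [hU hIco] with r hr
  have : T r hv.toLp = inner ℂ (x r) hv.toLp := rfl
  rw [this]
  simp only [x, dif_pos hr]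
  exact hinner _ _ (hF r hr) hv

theorem diffContOnCl_dilate {f : ℂ → ℂ} (hf : DifferentiableOn ℂ f unitDisk) {ρ : ℝ}
    (hρ : ρ ∈ Ico (0 : ℝ) 1) :
    DiffContOnCl ℂ (fun z => f (ρ * z)) (Metric.ball (0 : ℂ) 1) := by
  refine DifferentiableOn.diffContOnCl ?_
  rw [closure_ball _ one_ne_zero]
  refine hf.comp (by fun_prop) fun z hz => ?_
  rw [mem_closedBall_zero_iff] at hz
  rw [unitDisk, mem_ball_zero_iff, norm_mul, norm_real, Real.norm_of_nonneg hρ.1]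
  nlinarith [hρ.1, hρ.2, norm_nonneg z]

theorem continuous_radial {f : ℂ → ℂ} (hf : DifferentiableOn ℂ f unitDisk) {ρ : ℝ}
    (hρ : ρ ∈ Ico (0 : ℝ) 1) : Continuous fun θ => f (ρ * uc θ) := by
  refine hf.continuousOn.comp_continuous (by fun_prop) fun θ => radial_mem hρ.1 hρ.2 θ

theorem memLp_of_bound {φ : ℝ → ℂ} (hφ : AEStronglyMeasurable φ bMeasure) {C : ℝ}
    (hC : ∀ᵐ t ∂bMeasure, ‖φ t‖ ≤ C) : MemLp φ 2 bMeasure :=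
  MemLp.of_bound hφ C hC

theorem memLp_radial {f : ℂ → ℂ} (hf : DifferentiableOn ℂ f unitDisk) {ρ : ℝ}
    (hρ : ρ ∈ Ico (0 : ℝ) 1) : MemLp (fun θ => f (ρ * uc θ)) 2 bMeasure := by
  have hcont := continuous_radial hf hρ
  obtain ⟨C, hC⟩ := isCompact_Icc.exists_bound_of_continuousOn
    (hcont.continuousOn (s := Icc 0 (2 * Real.pi)))
  refine memLp_of_bound hcont.aestronglyMeasurable (C := C) ?_
  filter_upwards [ae_restrict_mem measurableSet_Ioc] with t ht
  exact hC t ⟨ht.1.le, ht.2⟩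

/-- The Szegő kernel, in the form in which it enters `szProj`. -/
def szk (z : ℂ) (θ : ℝ) : ℂ := (1 - z * (uc θ)⁻¹)⁻¹

theorem uc_ne_zero (θ : ℝ) : uc θ ≠ 0 := exp_ne_zero _

theorem szk_eq (z : ℂ) (θ : ℝ) : szk z θ = uc θ / (uc θ - z) := by
  have := uc_ne_zero θ
  rw [szk, ← inv_div, sub_div, div_self this, div_eq_mul_inv]

theorem continuous_szk {z : ℂ} (hz : z ∈ unitDisk) : Continuous (szk z) := by
  have : szk z = fun θ => uc θ / (uc θ - z) := funext (szk_eq z)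
  rw [this]
  exact Continuous.div (by fun_prop) (by fun_prop) fun t => uc_sub_ne_zero hz t

theorem norm_szk_le {z : ℂ} (hz : z ∈ unitDisk) (θ : ℝ) : ‖szk z θ‖ ≤ (1 - ‖z‖)⁻¹ := by
  rw [szk_eq, norm_div, norm_uc, one_div]
  rw [unitDisk, mem_ball_zero_iff] at hz
  have : 0 < 1 - ‖z‖ := by linarith
  have := sub_le_norm_uc_sub z θ
  gcongr

theorem memLp_szk {z : ℂ} (hz : z ∈ unitDisk) : MemLp (szk z) 2 bMeasure :=
  memLp_of_bound (continuous_szk hz).aestronglyMeasurable (ae_of_all _ (norm_szk_le hz))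

theorem szProj_eq (u : ℝ → ℂ) (z : ℂ) :
    szProj u z = (1 / (2 * (Real.pi : ℂ))) * ∫ θ, u θ * szk z θ ∂bMeasure := by
  rw [szProj, integral_bMeasure]; rfl

theorem MeasureTheory.MemLp.integrable_two {u : ℝ → ℂ} (hu : MemLp u 2 bMeasure) : Integrable u bMeasure :=
  hu.integrable (by norm_num)

theorem cauchy_dilate {f : ℂ → ℂ} (hf : DifferentiableOn ℂ f unitDisk) {ρ : ℝ}
    (hρ : ρ ∈ Ico (0 : ℝ) 1) {z : ℂ} (hz : z ∈ unitDisk) :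
    f (ρ * z) = (1 / (2 * (Real.pi : ℂ))) * ∫ θ, f (ρ * uc θ) * szk z θ ∂bMeasure := by
  have h := DiffContOnCl.circleAverage_smul_div (R := 1) (c := 0) (w := z)
    (by rw [abs_one]; exact diffContOnCl_dilate hf hρ) (by rw [abs_one]; exact hz)
  rw [circleAverage_eq] at h
  rw [← h]
  simp only [sub_zero, smul_eq_mul, szk_eq, mul_comm]

theorem poisson_dilate {f : ℂ → ℂ} (hf : DifferentiableOn ℂ f unitDisk) {ρ : ℝ}
    (hρ : ρ ∈ Ico (0 : ℝ) 1) {z : ℂ} (hz : z ∈ unitDisk) :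
    f (ρ * z) = (1 / (2 * (Real.pi : ℂ))) *
      ∫ θ, f (ρ * uc θ) * (poisson z (uc θ) : ℂ) ∂bMeasure := by
  have h := (diffContOnCl_dilate hf hρ).circleAverage_poissonKernel_smul' hz
  rw [circleAverage_eq] at h
  rw [← h]
  simp only [sub_zero, real_smul, norm_uc, one_pow, poisson, mul_comm]

theorem tendsto_dilate {f : ℂ → ℂ} (hf : DifferentiableOn ℂ f unitDisk) {z : ℂ}
    (hz : z ∈ unitDisk) :
    Tendsto (fun ρ : ℝ => f (ρ * z)) (nhdsWithin 1 (Iio 1)) (nhds (f z)) := by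
  have h1 : ContinuousAt f z := (hf.differentiableAt (Metric.isOpen_ball.mem_nhds hz)).continuousAt
  have h2 : Tendsto (fun ρ : ℝ => (ρ : ℂ) * z) (nhdsWithin 1 (Iio 1)) (nhds z) := by
    have : Continuous fun ρ : ℝ => (ρ : ℂ) * z := by fun_prop
    have := this.tendsto 1
    rw [ofReal_one, one_mul] at this
    exact tendsto_nhdsWithin_of_tendsto_nhds this
  exact h1.tendsto.comp h2

theorem eventually_mem_Ico : ∀ᶠ r : ℝ in nhdsWithin 1 (Iio 1), r ∈ Ico (0 : ℝ) 1 := by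
  filter_upwards [self_mem_nhdsWithin,
    mem_nhdsWithin_of_mem_nhds (Ioi_mem_nhds (zero_lt_one (α := ℝ)))] with r h1 h2
  exact ⟨le_of_lt h2, h1⟩

theorem MemH2.exists_boundary {f : ℂ → ℂ} (hf : MemH2 f) :
    ∃ u : ℝ → ℂ, MemLp u 2 bMeasure ∧
      (∀ᵐ θ ∂bMeasure, Tendsto (fun r : ℝ => f ((r : ℂ) * uc θ)) (nhdsWithin 1 (Iio 1))
        (nhds (u θ))) ∧ ∀ z ∈ unitDisk, szProj u z = f z := by
  obtain ⟨hd, C, hC⟩ := hf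
  obtain ⟨U, hU, hUle, u, hu, hlim⟩ := exists_weak_limit (F := fun r θ => f (r * uc θ))
    (fun r hr => memLp_radial hd hr) (C := C) (fun r hr => by
      rw [← integral_bMeasure]; exact hC r hr)
  refine ⟨u, hu, fatou_poisson hu.integrable_two fun z hz => ?_, fun z hz => ?_⟩
  · refine tendsto_nhds_unique ((tendsto_dilate hd hz).mono_left hUle) ?_
    refine ((hlim (fun θ => (poisson z (uc θ) : ℂ)) ?_).const_mul
      (1 / (2 * (Real.pi : ℂ)))).congr' ?_
    · refine memLp_of_bound (C := (1 - ‖z‖ ^ 2) / (1 - ‖z‖) ^ 2)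
        (continuous_ofReal.comp (continuous_poisson_uc hz)).aestronglyMeasurable
        (ae_of_all _ fun t => ?_)
      rw [norm_real]
      exact norm_poisson_le hz t
    · filter_upwards [hUle eventually_mem_Ico] with r hr
      exact (poisson_dilate hd hr hz).symm
  · rw [szProj_eq]
    refine (tendsto_nhds_unique ((tendsto_dilate hd hz).mono_left hUle) ?_).symm
    refine ((hlim (szk z) (memLp_szk hz)).const_mul (1 / (2 * (Real.pi : ℂ)))).congr' ?_
    filter_upwards [hUle eventually_mem_Ico] with r hr
    exact (cauchy_dilate hd hr hz).symm

theorem bdry_eq_of_tendsto {f : ℂ → ℂ} {θ : ℝ} {l : ℂ}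
    (h : Tendsto (fun r : ℝ => f ((r : ℂ) * uc θ)) (nhdsWithin 1 (Iio 1)) (nhds l)) :
    bdry f θ = l := h.limUnder_eq

theorem MemH2.tendsto_bdry {f : ℂ → ℂ} (hf : MemH2 f) :
    ∀ᵐ θ ∂bMeasure, Tendsto (fun r : ℝ => f ((r : ℂ) * uc θ)) (nhdsWithin 1 (Iio 1))
      (nhds (bdry f θ)) := by
  obtain ⟨u, -, hu, -⟩ := hf.exists_boundary
  filter_upwards [hu] with θ h
  rwa [bdry_eq_of_tendsto h]

theorem MemH2.memLp_bdry {f : ℂ → ℂ} (hf : MemH2 f) : MemLp (bdry f) 2 bMeasure := by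
  obtain ⟨u, hu2, hu, -⟩ := hf.exists_boundary
  refine hu2.ae_eq ?_
  filter_upwards [hu] with θ h
  exact (bdry_eq_of_tendsto h).symm

theorem szProj_congr {u v : ℝ → ℂ} (h : u =ᵐ[bMeasure] v) : szProj u = szProj v := by
  ext z
  rw [szProj_eq, szProj_eq]
  congr 1
  refine integral_congr_ae ?_
  filter_upwards [h] with θ h
  rw [h]

theorem MemH2.szProj_bdry {f : ℂ → ℂ} (hf : MemH2 f) {z : ℂ} (hz : z ∈ unitDisk) :
    szProj (bdry f) z = f z := by
  obtain ⟨u, hu2, hu, hs⟩ := hf.exists_boundary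
  rw [← hs z hz]
  refine congrFun (szProj_congr ?_) z
  filter_upwards [hu] with θ h
  exact bdry_eq_of_tendsto h

/-! ### Normalized averages over the circle -/

/-- The average of a function over the circle. -/
def avg (u : ℝ → ℂ) : ℂ := (1 / (2 * (Real.pi : ℂ))) * ∫ θ, u θ ∂bMeasure

theorem szProj_eq_avg (u : ℝ → ℂ) (z : ℂ) : szProj u z = avg fun θ => u θ * szk z θ :=
  szProj_eq u z

theorem bInner_eq_avg (f g : ℂ → ℂ) :
    bInner f g = avg fun θ => bdry f θ * (starRingEnd ℂ) (bdry g θ) := by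
  rw [bInner, integral_bMeasure]; rfl

theorem avg_congr {u v : ℝ → ℂ} (h : ∀ᵐ θ ∂bMeasure, u θ = v θ) : avg u = avg v := by
  rw [avg, avg, integral_congr_ae h]

theorem avg_add {u v : ℝ → ℂ} (hu : Integrable u bMeasure) (hv : Integrable v bMeasure) :
    avg (fun θ => u θ + v θ) = avg u + avg v := by
  rw [avg, avg, avg, integral_add hu hv, mul_add]

theorem avg_sub {u v : ℝ → ℂ} (hu : Integrable u bMeasure) (hv : Integrable v bMeasure) :
    avg (fun θ => u θ - v θ) = avg u - avg v := by
  rw [avg, avg, avg, integral_sub hu hv, mul_sub]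

theorem avg_const_mul (c : ℂ) (u : ℝ → ℂ) : avg (fun θ => c * u θ) = c * avg u := by
  rw [avg, avg, integral_const_mul, mul_left_comm]

theorem avg_mul_const (c : ℂ) (u : ℝ → ℂ) : avg (fun θ => u θ * c) = avg u * c := by
  rw [avg, avg, integral_mul_const, mul_assoc]

theorem avg_conj (u : ℝ → ℂ) :
    avg (fun θ => (starRingEnd ℂ) (u θ)) = (starRingEnd ℂ) (avg u) := by
  rw [avg, avg, integral_conj]
  simp only [map_mul, map_div₀, map_one, conj_ofReal, map_ofNat]

theorem avg_const (c : ℂ) : avg (fun _ => c) = c := by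
  have : (Real.pi : ℂ) ≠ 0 := ofReal_ne_zero.2 Real.pi_ne_zero
  rw [avg, integral_const, bMeasure_real_univ, real_smul]
  push_cast
  field_simp

theorem norm_avg_le (u : ℝ → ℂ) : ‖avg u‖ ≤ (1 / (2 * Real.pi)) * ∫ θ, ‖u θ‖ ∂bMeasure := by
  have : ‖(1 / (2 * (Real.pi : ℂ)))‖ = 1 / (2 * Real.pi) := by
    rw [norm_div, norm_mul, norm_real, Real.norm_of_nonneg Real.pi_pos.le]
    simp
  rw [avg, norm_mul, this]
  have := norm_integral_le_integral_norm (μ := bMeasure) u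
  have := Real.pi_pos
  gcongr

theorem avg_re {u : ℝ → ℂ} (hu : Integrable u bMeasure) :
    (avg u).re = (1 / (2 * Real.pi)) * ∫ θ, (u θ).re ∂bMeasure := by
  have h1 : (1 / (2 * (Real.pi : ℂ))) = ((1 / (2 * Real.pi) : ℝ) : ℂ) := by push_cast; rfl
  rw [avg, h1, re_ofReal_mul]
  congr 1
  exact (integral_re hu).symm

theorem MeasureTheory.MemLp.conj {u : ℝ → ℂ} (hu : MemLp u 2 bMeasure) :
    MemLp (fun θ => (starRingEnd ℂ) (u θ)) 2 bMeasure := hu.star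

theorem MeasureTheory.MemLp.bdd_mul_two {u φ : ℝ → ℂ} (hu : MemLp u 2 bMeasure)
    (hφ : AEStronglyMeasurable φ bMeasure) {C : ℝ} (hC : ∀ᵐ t ∂bMeasure, ‖φ t‖ ≤ C) :
    MemLp (fun t => φ t * u t) 2 bMeasure := by
  refine (hu.const_mul (C : ℂ)).of_le (hφ.mul hu.1) ?_
  filter_upwards [hC] with t ht
  rw [norm_mul, norm_mul, norm_real]
  have := ht.trans (le_abs_self C)
  rw [Real.norm_eq_abs]
  gcongr

theorem MeasureTheory.MemLp.integrable_mul_two {u v : ℝ → ℂ} (hu : MemLp u 2 bMeasure)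
    (hv : MemLp v 2 bMeasure) : Integrable (fun θ => u θ * v θ) bMeasure :=
  hu.integrable_mul hv

theorem conj_uc (θ : ℝ) : (starRingEnd ℂ) (uc θ) = (uc θ)⁻¹ := by
  rw [inv_def, normSq_eq_norm_sq, norm_uc]
  simp

theorem conj_szk (z : ℂ) (θ : ℝ) : (starRingEnd ℂ) (szk z θ) = szKernel z (uc θ) := by
  simp [szk, szKernel, ← conj_uc]

theorem uc_mul_szk {z : ℂ} (hz : z ∈ unitDisk) (θ : ℝ) : uc θ * szk z θ = uc θ + z * szk z θ := by
  have := uc_sub_ne_zero hz θ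
  rw [szk_eq]
  field_simp
  ring

theorem mul_conj_uc_mul_szk {z : ℂ} (hz : z ∈ unitDisk) (θ : ℝ) :
    z * ((starRingEnd ℂ) (uc θ) * szk z θ) = szk z θ - 1 := by
  have := uc_sub_ne_zero hz θ
  have := uc_ne_zero θ
  rw [szk_eq, conj_uc]
  field_simp
  ring

theorem zero_mem_unitDisk : (0 : ℂ) ∈ unitDisk := by simp [unitDisk]

@[simp] theorem szk_zero (θ : ℝ) : szk 0 θ = 1 := by simp [szk]

/-! ### Closure properties of Hardy classes -/

theorem eventually_radial_mem (θ : ℝ) :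
    ∀ᶠ r : ℝ in nhdsWithin 1 (Iio 1), (r : ℂ) * uc θ ∈ unitDisk := by
  filter_upwards [eventually_mem_Ico] with r hr
  exact radial_mem hr.1 hr.2 θ

theorem bdry_congr {f g : ℂ → ℂ} (h : ∀ z ∈ unitDisk, f z = g z) : bdry f = bdry g := by
  ext θ
  unfold bdry radLim limUnder
  congr 1
  refine Filter.map_congr ?_
  filter_upwards [eventually_radial_mem θ] with r hr
  exact h _ hr

theorem MemH2.congr {f g : ℂ → ℂ} (hf : MemH2 f) (h : ∀ z ∈ unitDisk, g z = f z) : MemH2 g := by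
  obtain ⟨hd, C, hC⟩ := hf
  refine ⟨hd.congr h, C, fun r hr => ?_⟩
  have : (fun θ => ‖g ((r : ℂ) * uc θ)‖ ^ 2) = fun θ => ‖f ((r : ℂ) * uc θ)‖ ^ 2 := by
    ext θ
    rw [h _ (radial_mem hr.1 hr.2 θ)]
  rw [this]
  exact hC r hr

theorem integrable_norm_sq_radial {f : ℂ → ℂ} (hf : DifferentiableOn ℂ f unitDisk) {r : ℝ}
    (hr : r ∈ Ico (0 : ℝ) 1) : Integrable (fun θ => ‖f ((r : ℂ) * uc θ)‖ ^ 2) bMeasure :=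
  (memLp_radial hf hr).integrable_norm_pow (by norm_num)

theorem MemH2.of_norm_sq_le {f : ℂ → ℂ} (hd : DifferentiableOn ℂ f unitDisk)
    {g₁ g₂ : ℂ → ℂ} (hg₁ : MemH2 g₁) (hg₂ : MemH2 g₂) {C₁ C₂ : ℝ} (h1 : 0 ≤ C₁) (h2 : 0 ≤ C₂)
    (h : ∀ z ∈ unitDisk, ‖f z‖ ^ 2 ≤ C₁ * ‖g₁ z‖ ^ 2 + C₂ * ‖g₂ z‖ ^ 2) : MemH2 f := by
  obtain ⟨hd₁, D₁, hD₁⟩ := hg₁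
  obtain ⟨hd₂, D₂, hD₂⟩ := hg₂
  refine ⟨hd, C₁ * D₁ + C₂ * D₂, fun r hr => ?_⟩
  have e1 := hD₁ r hr
  have e2 := hD₂ r hr
  rw [integral_bMeasure] at *
  have i1 := (integrable_norm_sq_radial hd₁ hr).const_mul C₁
  have i2 := (integrable_norm_sq_radial hd₂ hr).const_mul C₂
  calc _ ≤ ∫ θ, (C₁ * ‖g₁ ((r : ℂ) * uc θ)‖ ^ 2 + C₂ * ‖g₂ ((r : ℂ) * uc θ)‖ ^ 2) ∂bMeasure :=
        integral_mono (integrable_norm_sq_radial hd hr) (i1.add i2)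
          fun θ => h _ (radial_mem hr.1 hr.2 θ)
    _ ≤ _ := by
        rw [integral_add i1 i2, integral_const_mul, integral_const_mul]
        gcongr

theorem memH2_const (c : ℂ) : MemH2 fun _ => c :=
  ⟨differentiableOn_const c, 2 * Real.pi * ‖c‖ ^ 2, fun r hr => by simp⟩

theorem MemH2.add {f g : ℂ → ℂ} (hf : MemH2 f) (hg : MemH2 g) : MemH2 fun z => f z + g z := by
  refine MemH2.of_norm_sq_le (hf.1.add hg.1) hf hg zero_le_two zero_le_two fun z _ => ?_
  have := norm_add_le (f z) (g z)
  nlinarith [sq_nonneg (‖f z‖ - ‖g z‖), norm_nonneg (f z + g z)]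

theorem MemHinf.mul_memH2 {φ f : ℂ → ℂ} (hφ : MemHinf φ) (hf : MemH2 f) :
    MemH2 fun z => φ z * f z := by
  obtain ⟨hd, C, hC⟩ := hφ
  refine MemH2.of_norm_sq_le (hd.mul hf.1) hf hf (sq_nonneg C) (sq_nonneg C) fun z hz => ?_
  have := hC z hz
  rw [norm_mul, mul_pow]
  have : ‖φ z‖ ^ 2 ≤ C ^ 2 := by gcongr
  nlinarith [sq_nonneg ‖f z‖, mul_nonneg (sq_nonneg C) (sq_nonneg ‖f z‖)]

theorem memHinf_const (c : ℂ) : MemHinf fun _ => c :=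
  ⟨differentiableOn_const c, ‖c‖, fun _ _ => le_rfl⟩

theorem MemH2.const_mul {f : ℂ → ℂ} (hf : MemH2 f) (c : ℂ) : MemH2 fun z => c * f z :=
  (memHinf_const c).mul_memH2 hf

theorem MemHinf.memH2 {φ : ℂ → ℂ} (hφ : MemHinf φ) : MemH2 φ :=
  (hφ.mul_memH2 (memH2_const 1)).congr fun z _ => by simp

theorem MemHinf.mul {φ ψ : ℂ → ℂ} (hφ : MemHinf φ) (hψ : MemHinf ψ) :
    MemHinf fun z => φ z * ψ z := by
  obtain ⟨hd, C, hC⟩ := hφ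
  obtain ⟨hd', D, hD⟩ := hψ
  refine ⟨hd.mul hd', C * D, fun z hz => ?_⟩
  rw [norm_mul]
  exact mul_le_mul (hC z hz) (hD z hz) (norm_nonneg _) ((norm_nonneg _).trans (hC z hz))

theorem memHinf_id : MemHinf fun z => z :=
  ⟨differentiableOn_id, 1, fun z hz => by
    rw [unitDisk, mem_ball_zero_iff] at hz; exact hz.le⟩

theorem MemHinf.sub {φ ψ : ℂ → ℂ} (hφ : MemHinf φ) (hψ : MemHinf ψ) :
    MemHinf fun z => φ z - ψ z := by
  obtain ⟨hd, C, hC⟩ := hφ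
  obtain ⟨hd', D, hD⟩ := hψ
  exact ⟨hd.sub hd', C + D, fun z hz => (norm_sub_le _ _).trans (add_le_add (hC z hz) (hD z hz))⟩

theorem one_sub_conj_mul_bound {w z : ℂ} (hz : z ∈ unitDisk) :
    1 - ‖w‖ ≤ ‖1 - (starRingEnd ℂ) w * z‖ := by
  rw [unitDisk, mem_ball_zero_iff] at hz
  have := norm_sub_norm_le 1 ((starRingEnd ℂ) w * z)
  rw [norm_one, norm_mul, RCLike.norm_conj] at this
  nlinarith [norm_nonneg w, norm_nonneg z]

theorem one_sub_conj_mul_ne_zero {w z : ℂ} (hw : ‖w‖ ≤ 1) (hz : z ∈ unitDisk) :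
    1 - (starRingEnd ℂ) w * z ≠ 0 := by
  rw [unitDisk, mem_ball_zero_iff] at hz
  have := norm_sub_norm_le 1 ((starRingEnd ℂ) w * z)
  rw [norm_one, norm_mul, RCLike.norm_conj] at this
  rw [← norm_pos_iff]
  nlinarith [norm_nonneg w, norm_nonneg z]

theorem memHinf_szKernel {w : ℂ} (hw : w ∈ unitDisk) : MemHinf (szKernel w) := by
  have hw' := hw
  rw [unitDisk, mem_ball_zero_iff] at hw'
  refine ⟨?_, (1 - ‖w‖)⁻¹, fun z hz => ?_⟩
  · unfold szKernel
    refine DifferentiableOn.inv (by fun_prop) fun z hz => one_sub_conj_mul_ne_zero hw'.le hz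
  · rw [szKernel, norm_inv]
    have : 0 < 1 - ‖w‖ := by linarith
    have := one_sub_conj_mul_bound (w := w) hz
    gcongr

theorem bdry_mul {f g : ℂ → ℂ} (hf : MemH2 f) (hg : MemH2 g) :
    ∀ᵐ θ ∂bMeasure, bdry (fun z => f z * g z) θ = bdry f θ * bdry g θ := by
  filter_upwards [hf.tendsto_bdry, hg.tendsto_bdry] with θ h1 h2
  exact bdry_eq_of_tendsto (h1.mul h2)

theorem bdry_add {f g : ℂ → ℂ} (hf : MemH2 f) (hg : MemH2 g) :
    ∀ᵐ θ ∂bMeasure, bdry (fun z => f z + g z) θ = bdry f θ + bdry g θ := by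
  filter_upwards [hf.tendsto_bdry, hg.tendsto_bdry] with θ h1 h2
  exact bdry_eq_of_tendsto (h1.add h2)

theorem bdry_const (c : ℂ) (θ : ℝ) : bdry (fun _ => c) θ = c :=
  bdry_eq_of_tendsto tendsto_const_nhds

theorem bdry_const_mul {f : ℂ → ℂ} (hf : MemH2 f) (c : ℂ) :
    ∀ᵐ θ ∂bMeasure, bdry (fun z => c * f z) θ = c * bdry f θ := by
  filter_upwards [bdry_mul (memH2_const c) hf] with θ h
  rw [h, bdry_const]

theorem bdry_of_continuousAt {f : ℂ → ℂ} {θ : ℝ} (h : ContinuousAt f (uc θ)) :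
    bdry f θ = f (uc θ) := by
  refine bdry_eq_of_tendsto (h.tendsto.comp ?_)
  have : Continuous fun r : ℝ => (r : ℂ) * uc θ := by fun_prop
  have := this.tendsto 1
  rw [ofReal_one, one_mul] at this
  exact tendsto_nhdsWithin_of_tendsto_nhds this

theorem bdry_id (θ : ℝ) : bdry (fun z => z) θ = uc θ :=
  bdry_of_continuousAt (f := fun z => z) continuousAt_id

theorem bdry_szKernel {w : ℂ} (hw : w ∈ unitDisk) (θ : ℝ) :
    bdry (szKernel w) θ = (starRingEnd ℂ) (szk w θ) := by
  rw [conj_szk]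
  refine bdry_of_continuousAt ?_
  unfold szKernel
  refine ContinuousAt.inv₀ (by fun_prop) ?_
  rw [unitDisk, mem_ball_zero_iff] at hw
  have := norm_sub_norm_le 1 ((starRingEnd ℂ) w * uc θ)
  rw [norm_one, norm_mul, RCLike.norm_conj, norm_uc] at this
  rw [← norm_pos_iff]
  linarith

theorem bdry_mul_id {f : ℂ → ℂ} (hf : MemH2 f) :
    ∀ᵐ θ ∂bMeasure, bdry (fun z => z * f z) θ = uc θ * bdry f θ := by
  filter_upwards [bdry_mul memHinf_id.memH2 hf] with θ h
  rw [h, bdry_id]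

theorem MemHinf.exists_bound_bdry {φ : ℂ → ℂ} (hφ : MemHinf φ) :
    ∃ C : ℝ, ∀ᵐ θ ∂bMeasure, ‖bdry φ θ‖ ≤ C := by
  obtain ⟨C, hC⟩ := hφ.2
  refine ⟨C, ?_⟩
  filter_upwards [hφ.memH2.tendsto_bdry] with θ h
  refine le_of_tendsto h.norm ?_
  filter_upwards [eventually_radial_mem θ] with r hr
  exact hC _ hr

theorem MemHinf.memLp_mul {φ : ℂ → ℂ} (hφ : MemHinf φ) {u : ℝ → ℂ} (hu : MemLp u 2 bMeasure) :
    MemLp (fun θ => bdry φ θ * u θ) 2 bMeasure := by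
  obtain ⟨C, hC⟩ := hφ.exists_bound_bdry
  exact hu.bdd_mul_two hφ.memH2.memLp_bdry.1 hC

theorem MemHinf.memLp_conj_mul {φ : ℂ → ℂ} (hφ : MemHinf φ) {u : ℝ → ℂ}
    (hu : MemLp u 2 bMeasure) :
    MemLp (fun θ => (starRingEnd ℂ) (bdry φ θ) * u θ) 2 bMeasure := by
  have := (hφ.memLp_mul hu.conj).conj
  simpa using this

theorem memLp_uc_mul {u : ℝ → ℂ} (hu : MemLp u 2 bMeasure) :
    MemLp (fun θ => uc θ * u θ) 2 bMeasure :=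
  hu.bdd_mul_two continuous_uc.aestronglyMeasurable (C := 1)
    (ae_of_all _ fun θ => (norm_uc θ).le)

theorem MemH2.avg_mul_szk {f : ℂ → ℂ} (hf : MemH2 f) {z : ℂ} (hz : z ∈ unitDisk) :
    avg (fun θ => bdry f θ * szk z θ) = f z := by
  rw [← szProj_eq_avg, hf.szProj_bdry hz]

theorem MemH2.avg_bdry {f : ℂ → ℂ} (hf : MemH2 f) : avg (bdry f) = f 0 := by
  rw [← hf.avg_mul_szk zero_mem_unitDisk]
  simp

/-- The projection of `ū k_w` for `u` in `H^∞`. -/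
theorem avg_conj_bdry_mul {φ : ℂ → ℂ} (hφ : MemHinf φ) {w z : ℂ} (hw : w ∈ unitDisk)
    (hz : z ∈ unitDisk) :
    avg (fun θ => (starRingEnd ℂ) (bdry φ θ) * bdry (szKernel w) θ * szk z θ) =
      (starRingEnd ℂ) (φ w) * szKernel w z := by
  have h := (hφ.mul_memH2 (memHinf_szKernel hz).memH2).avg_mul_szk hw
  have h2 : (starRingEnd ℂ) (φ w) * szKernel w z = (starRingEnd ℂ) (φ w * szKernel z w) := by
    simp [szKernel, mul_comm]
  rw [h2, ← h, ← avg_conj]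
  refine avg_congr ?_
  filter_upwards [bdry_mul hφ.memH2 (memHinf_szKernel hz).memH2] with θ h3
  rw [h3, bdry_szKernel hz, bdry_szKernel hw]
  simp
  ring

theorem szKernel_zero : szKernel 0 = fun _ => 1 := by
  ext z; simp [szKernel]

theorem avg_conj_bdry_mul_szk {φ : ℂ → ℂ} (hφ : MemHinf φ) {z : ℂ} (hz : z ∈ unitDisk) :
    avg (fun θ => (starRingEnd ℂ) (bdry φ θ) * szk z θ) = (starRingEnd ℂ) (φ 0) := by
  have := avg_conj_bdry_mul hφ zero_mem_unitDisk hz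
  simpa [szKernel_zero, bdry_const] using this

theorem avg_szk {z : ℂ} (hz : z ∈ unitDisk) : avg (szk z) = 1 := by
  have := (memH2_const 1).avg_mul_szk hz
  simpa [bdry_const] using this

theorem szProj_uc_mul {u : ℝ → ℂ} (hu : MemLp u 2 bMeasure) {z : ℂ} (hz : z ∈ unitDisk) :
    avg (fun θ => uc θ * u θ * szk z θ) =
      z * avg (fun θ => u θ * szk z θ) + avg (fun θ => uc θ * u θ) := by
  rw [← avg_const_mul, ← avg_add]
  · refine avg_congr (ae_of_all _ fun θ => ?_)
    have := uc_mul_szk hz θ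
    linear_combination u θ * this
  · exact (hu.integrable_mul_two (memLp_szk hz)).const_mul z
  · exact (memLp_uc_mul hu).integrable_two

/-! ### Outer functions and injectivity of co-analytic Toeplitz operators -/

/-- The Herglotz kernel of the unit disk. -/
def herg (z : ℂ) (θ : ℝ) : ℂ := (uc θ + z) / (uc θ - z)

theorem herg_re (z : ℂ) (θ : ℝ) : (herg z θ).re = poisson z (uc θ) := by
  have := congrFun (poissonKernel_eq_re_herglotzRieszKernel (c := 0) (w := z)) (uc θ)
  simp only [poissonKernel, sub_zero, norm_uc, one_pow, Function.comp_apply,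
    herglotzRieszKernel] at this
  rw [herg, ← this, poisson]

theorem continuous_herg {z : ℂ} (hz : z ∈ unitDisk) : Continuous (herg z) :=
  Continuous.div (by fun_prop) (by fun_prop) fun t => uc_sub_ne_zero hz t

theorem norm_herg_le {z : ℂ} (hz : z ∈ unitDisk) (θ : ℝ) : ‖herg z θ‖ ≤ 2 / (1 - ‖z‖) := by
  have h1 := sub_le_norm_uc_sub z θ
  have h2 := norm_add_le (uc θ) z
  rw [norm_uc] at h2
  rw [unitDisk, mem_ball_zero_iff] at hz
  have : 0 < 1 - ‖z‖ := by linarith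
  rw [herg, norm_div]
  gcongr
  linarith

theorem poisson_nonneg {z : ℂ} (hz : z ∈ unitDisk) (ζ : ℂ) : 0 ≤ poisson z ζ := by
  rw [unitDisk, mem_ball_zero_iff] at hz
  have : 0 ≤ 1 - ‖z‖ ^ 2 := by nlinarith [norm_nonneg z]
  unfold poisson
  positivity

theorem integrable_herg_mul {v : ℝ → ℂ} (hv : Integrable v bMeasure) {z : ℂ}
    (hz : z ∈ unitDisk) : Integrable (fun θ => herg z θ * v θ) bMeasure := by
  simpa only [mul_comm] using
    integrable_bdd_mul hv (continuous_herg hz).aestronglyMeasurable (norm_herg_le hz)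

theorem differentiableOn_avg_herg {V : ℂ → ℂ} (hV : Integrable (fun θ => V (uc θ)) bMeasure) :
    DifferentiableOn ℂ (fun z => avg fun θ => herg z θ * V (uc θ)) unitDisk := by
  have h : CircleIntegrable V 0 1 := by
    rw [CircleIntegrable, intervalIntegrable_iff, uIoc_of_le Real.two_pi_pos.le]
    simpa [circleMap, uc, IntegrableOn, bMeasure] using hV
  have h2 := differentiableOn_circleAverage_herglotzRieszKernel_smul h
  refine h2.congr fun z hz => ?_
  rw [circleAverage_eq]
  simp [avg, herg, herglotzRieszKernel]

theorem re_avg_herg_mul {v : ℝ → ℝ} {z : ℂ}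
    (hi : Integrable (fun θ => herg z θ * (v θ : ℂ)) bMeasure) :
    (avg fun θ => herg z θ * (v θ : ℂ)).re =
      (1 / (2 * Real.pi)) * ∫ θ, poisson z (uc θ) * v θ ∂bMeasure := by
  rw [avg_re hi]
  simp only [re_mul_ofReal, herg_re]

theorem norm_exp_avg_herg_le_one {v : ℝ → ℝ} (hv : ∀ᵐ θ ∂bMeasure, v θ ≤ 0) {z : ℂ}
    (hz : z ∈ unitDisk) : ‖exp (avg fun θ => herg z θ * (v θ : ℂ))‖ ≤ 1 := by
  rw [norm_exp, Real.exp_le_one_iff]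
  by_cases hi : Integrable (fun θ => herg z θ * (v θ : ℂ)) bMeasure
  · rw [re_avg_herg_mul hi]
    refine mul_nonpos_of_nonneg_of_nonpos (by have := Real.pi_pos; positivity) ?_
    refine integral_nonpos_of_ae ?_
    filter_upwards [hv] with θ h
    exact mul_nonpos_of_nonneg_of_nonpos (poisson_nonneg hz _) h
  · rw [avg, integral_undef hi]
    simp

theorem norm_exp_avg_herg_le {v : ℝ → ℝ} {C : ℝ} (hvi : Integrable v bMeasure)
    (hv : ∀ᵐ θ ∂bMeasure, v θ ≤ C) {z : ℂ}
    (hz : z ∈ unitDisk) : ‖exp (avg fun θ => herg z θ * (v θ : ℂ))‖ ≤ Real.exp C := by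
  have hi : Integrable (fun θ => herg z θ * (v θ : ℂ)) bMeasure := integrable_herg_mul hvi.ofReal hz
  have hp : Integrable (fun θ => poisson z (uc θ)) bMeasure :=
    Integrable.of_bound (continuous_poisson_uc hz).aestronglyMeasurable
      ((1 - ‖z‖ ^ 2) / (1 - ‖z‖) ^ 2) (ae_of_all _ (norm_poisson_le hz))
  have hp1 : (1 / (2 * Real.pi)) * ∫ θ, poisson z (uc θ) ∂bMeasure = 1 := by
    have := integral_poisson hz
    rw [integral_complex_ofReal] at this
    exact_mod_cast this
  rw [norm_exp, Real.exp_le_exp, re_avg_herg_mul hi]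
  calc _ ≤ (1 / (2 * Real.pi)) * ∫ θ, poisson z (uc θ) * C ∂bMeasure := by
        have := Real.pi_pos
        refine mul_le_mul_of_nonneg_left ?_ (by positivity)
        refine integral_mono_ae ?_ (hp.mul_const C) ?_
        · have := hi.re
          refine this.congr (ae_of_all _ fun θ => ?_)
          change (herg z θ * (v θ : ℂ)).re = _
          rw [re_mul_ofReal, herg_re]
        · filter_upwards [hv] with θ h
          exact mul_le_mul_of_nonneg_left h (poisson_nonneg hz _)
    _ = C := by rw [integral_mul_const, ← mul_assoc, hp1, one_mul]

theorem IsOuter.exists_eq {a : ℂ → ℂ} (ha : IsOuter a) : ∃ c : ℂ, ‖c‖ = 1 ∧ ∀ z ∈ unitDisk,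
    a z = c * exp (avg fun θ => herg z θ * ((Real.log ‖bdry a θ‖ : ℝ) : ℂ)) := by
  obtain ⟨-, c, hc, h⟩ := ha
  refine ⟨c, hc, fun z hz => ?_⟩
  rw [h z hz, integral_bMeasure]
  rfl

theorem IsOuter.norm_le_one {a : ℂ → ℂ} (ha : IsOuter a)
    (hle : ∀ᵐ θ ∂bMeasure, ‖bdry a θ‖ ≤ 1) {z : ℂ} (hz : z ∈ unitDisk) : ‖a z‖ ≤ 1 := by
  obtain ⟨c, hc, h⟩ := ha.exists_eq
  rw [h z hz, norm_mul, hc, one_mul]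
  refine norm_exp_avg_herg_le_one ?_ hz
  filter_upwards [hle] with θ h
  exact Real.log_nonpos (norm_nonneg _) h

theorem IsOuter.ne_zero {a : ℂ → ℂ} (ha : IsOuter a) {z : ℂ} (hz : z ∈ unitDisk) : a z ≠ 0 := by
  obtain ⟨c, hc, h⟩ := ha.exists_eq
  rw [h z hz]
  refine mul_ne_zero (fun h0 => ?_) (exp_ne_zero _)
  simp [h0] at hc

/-- A square-integrable function with vanishing Riesz projection is orthogonal to `H^∞`. -/
theorem avg_mul_conj_eq_zero {u : ℝ → ℂ} (hu : MemLp u 2 bMeasure)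
    (h0 : ∀ z ∈ unitDisk, avg (fun θ => u θ * szk z θ) = 0) {φ : ℂ → ℂ} (hφ : MemHinf φ) :
    avg (fun θ => u θ * (starRingEnd ℂ) (bdry φ θ)) = 0 := by
  obtain ⟨C, hC⟩ := hφ.2
  have hlim : Tendsto (fun r : ℝ => ∫ θ, u θ * (starRingEnd ℂ) (φ (r * uc θ)) ∂bMeasure)
      (nhdsWithin 1 (Iio 1)) (nhds (∫ θ, u θ * (starRingEnd ℂ) (bdry φ θ) ∂bMeasure)) := by
    refine tendsto_integral_filter_of_dominated_convergence (fun θ => ‖u θ‖ * C) ?_ ?_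
      (hu.integrable_two.norm.mul_const C) ?_
    · filter_upwards [eventually_mem_Ico] with r hr
      exact hu.1.mul (continuous_conj.comp (continuous_radial hφ.1 hr)).aestronglyMeasurable
    · filter_upwards [eventually_mem_Ico] with r hr
      refine ae_of_all _ fun θ => ?_
      rw [norm_mul, RCLike.norm_conj]
      have := hC _ (radial_mem hr.1 hr.2 θ)
      gcongr
    · filter_upwards [hφ.memH2.tendsto_bdry] with θ h
      exact tendsto_const_nhds.mul ((continuous_conj.tendsto _).comp h)
  have hzero : ∀ᶠ r : ℝ in nhdsWithin 1 (Iio 1),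
      ∫ θ, u θ * (starRingEnd ℂ) (φ (r * uc θ)) ∂bMeasure = 0 := by
    filter_upwards [eventually_mem_Ico] with r hr
    have h1 : ∀ θ, u θ * (starRingEnd ℂ) (φ (r * uc θ)) =
        (1 / (2 * (Real.pi : ℂ))) *
          ∫ t, u θ * ((starRingEnd ℂ) (bdry φ t) * szk (r * uc t) θ) ∂bMeasure := by
      intro θ
      rw [← hφ.memH2.avg_mul_szk (radial_mem hr.1 hr.2 θ), ← avg_conj, avg, mul_left_comm,
        ← integral_const_mul]
      refine congrArg _ (integral_congr_ae (ae_of_all _ fun t => ?_))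
      simp only [map_mul]
      congr 2
      simp only [szk, map_inv₀, map_sub, map_mul, map_one, conj_ofReal, conj_uc, inv_inv]
      ring_nf
    simp_rw [h1]
    rw [integral_const_mul, integral_integral_swap]
    · have h2 : ∀ t, ∫ θ, u θ * ((starRingEnd ℂ) (bdry φ t) * szk (r * uc t) θ) ∂bMeasure = 0 := by
        intro t
        have h3 := h0 _ (radial_mem hr.1 hr.2 t)
        have h4 : ∫ θ, u θ * szk (r * uc t) θ ∂bMeasure = 0 := by
          rw [avg] at h3
          refine (mul_eq_zero.1 h3).resolve_left ?_
          have : (Real.pi : ℂ) ≠ 0 := ofReal_ne_zero.2 Real.pi_ne_zero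
          simp [this]
        simp_rw [mul_left_comm (u _)]
        rw [integral_const_mul, h4, mul_zero]
      simp_rw [h2]
      simp
    · have h5 : Integrable (fun p : ℝ × ℝ => u p.1 * (starRingEnd ℂ) (bdry φ p.2))
          (bMeasure.prod bMeasure) :=
        hu.integrable_two.mul_prod hφ.memH2.memLp_bdry.conj.integrable_two
      have h6 : Integrable (fun p : ℝ × ℝ => (u p.1 * (starRingEnd ℂ) (bdry φ p.2)) *
          szk (r * uc p.2) p.1) (bMeasure.prod bMeasure) := by
        refine h5.mul_bdd (c := (1 - r)⁻¹) ?_ (ae_of_all _ fun p => ?_)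
        · have : (fun p : ℝ × ℝ => szk (r * uc p.2) p.1) =
              fun p : ℝ × ℝ => uc p.1 / (uc p.1 - r * uc p.2) := by
            ext p; rw [szk_eq]
          rw [this]
          refine Continuous.aestronglyMeasurable ?_
          exact Continuous.div (by fun_prop) (by fun_prop)
            fun p => uc_sub_ne_zero (radial_mem hr.1 hr.2 p.2) p.1
        · have := norm_szk_le (radial_mem hr.1 hr.2 p.2) p.1
          rwa [norm_radial hr.1] at this
      refine h6.congr (ae_of_all _ fun p => ?_)
      simp only [Function.uncurry]
      ring
  rw [avg, tendsto_nhds_unique hlim (tendsto_const_nhds.congr' ?_), mul_zero]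
  filter_upwards [hzero] with r hr
  exact hr.symm

theorem norm_avg_mul_le {u v : ℝ → ℂ} (hu : MemLp u 2 bMeasure) (hv : MemLp v 2 bMeasure) :
    ‖avg fun θ => u θ * v θ‖ ≤ (1 / (2 * Real.pi)) *
      (Real.sqrt (∫ θ, ‖u θ‖ ^ 2 ∂bMeasure) * Real.sqrt (∫ θ, ‖v θ‖ ^ 2 ∂bMeasure)) := by
  refine (norm_avg_le _).trans ?_
  have := Real.pi_pos
  refine mul_le_mul_of_nonneg_left ?_ (by positivity)
  simp only [norm_mul]
  have h := integral_mul_norm_le_Lp_mul_Lq (μ := bMeasure) (f := u) (g := v) (p := 2) (q := 2)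
    (by constructor <;> norm_num) (by simpa using hu) (by simpa using hv)
  simpa only [Real.sqrt_eq_rpow, Real.rpow_two] using h

/-- For an outer function `a` there are bounded functions `φ n` with `a φ n` in the unit ball of
`H^∞` converging to a unimodular constant in `L²`. -/
theorem IsOuter.exists_approx {a : ℂ → ℂ} (ha : IsOuter a)
    (hle : ∀ᵐ θ ∂bMeasure, ‖bdry a θ‖ ≤ 1)
    (hL : Integrable (fun θ => Real.log ‖bdry a θ‖) bMeasure) :
    ∃ c : ℂ, ‖c‖ = 1 ∧ ∃ φ : ℕ → ℂ → ℂ, (∀ n, MemHinf (φ n)) ∧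
      (∀ n, ∀ z ∈ unitDisk, ‖a z * φ n z‖ ≤ 1) ∧
      Tendsto (fun n => a 0 * φ n 0) atTop (nhds c) := by
  obtain ⟨c, hc, h⟩ := ha.exists_eq
  have hLle : ∀ᵐ θ ∂bMeasure, Real.log ‖bdry a θ‖ ≤ 0 := by
    filter_upwards [hle] with θ h
    exact Real.log_nonpos (norm_nonneg _) h
  let V : ℕ → ℂ → ℝ := fun n ζ => min (-Real.log ‖radLim a ζ‖) n
  have hVi : ∀ n, Integrable (fun θ => V n (uc θ)) bMeasure := fun n =>
    hL.neg.inf (integrable_const (n : ℝ))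
  have hVn : ∀ n θ, V n (uc θ) ≤ n := fun n θ => min_le_right _ _
  have hsum : ∀ n, ∀ z ∈ unitDisk, a z * exp (avg fun θ => herg z θ * (V n (uc θ) : ℂ)) =
      c * exp (avg fun θ => herg z θ * ((Real.log ‖bdry a θ‖ + V n (uc θ) : ℝ) : ℂ)) := by
    intro n z hz
    rw [h z hz, mul_assoc, ← exp_add, ← avg_add]
    · simp only [ofReal_add, mul_add]
    · exact integrable_herg_mul hL.ofReal hz
    · exact integrable_herg_mul (hVi n).ofReal hz
  have hneg : ∀ n, ∀ θ, Real.log ‖bdry a θ‖ + V n (uc θ) ≤ 0 := by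
    intro n θ
    have : V n (uc θ) ≤ -Real.log ‖bdry a θ‖ := min_le_left _ _
    linarith
  refine ⟨c, hc, fun n z => exp (avg fun θ => herg z θ * (V n (uc θ) : ℂ)), fun n => ⟨?_, ?_⟩,
    fun n z hz => ?_, ?_⟩
  · exact (differentiableOn_avg_herg (V := fun ζ => (V n ζ : ℂ)) (hVi n).ofReal).cexp
  · exact ⟨Real.exp n, fun z hz => norm_exp_avg_herg_le (hVi n) (ae_of_all _ (hVn n)) hz⟩
  · rw [hsum n z hz, norm_mul, hc, one_mul]
    exact norm_exp_avg_herg_le_one (ae_of_all _ (hneg n)) hz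
  · simp_rw [fun n => hsum n 0 zero_mem_unitDisk]
    have hh : ∀ θ, herg 0 θ = 1 := fun θ => by simp [herg, uc_ne_zero]
    simp only [hh, one_mul]
    have hlim : Tendsto (fun n : ℕ =>
        ∫ θ, ((Real.log ‖bdry a θ‖ + V n (uc θ) : ℝ) : ℂ) ∂bMeasure) atTop
        (nhds (∫ _, (0 : ℂ) ∂bMeasure)) := by
      refine tendsto_integral_of_dominated_convergence (fun θ => |Real.log ‖bdry a θ‖|)
        (fun n => (hL.add (hVi n)).ofReal.1) hL.abs (fun n => ?_) (ae_of_all _ fun θ => ?_)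
      · filter_upwards [hLle] with θ h1
        have h2 := hneg n θ
        have h3 : 0 ≤ V n (uc θ) := le_min (neg_nonneg.2 h1) n.cast_nonneg
        rw [norm_real, Real.norm_eq_abs, abs_of_nonpos h2, abs_of_nonpos h1]
        linarith
      · refine tendsto_const_nhds.congr' ?_
        filter_upwards [eventually_ge_atTop ⌈-Real.log ‖bdry a θ‖⌉₊] with n hn
        have : V n (uc θ) = -Real.log ‖bdry a θ‖ := min_eq_left (Nat.ceil_le.1 hn)
        rw [this]
        simp
    have := ((continuous_exp.tendsto _).comp (hlim.const_mul (1 / (2 * (Real.pi : ℂ))))).const_mul c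
    simpa [avg, Function.comp_def] using this

/-- A co-analytic Toeplitz operator with outer symbol is injective. -/
theorem IsOuter.eq_zero_of_avg {a : ℂ → ℂ} (ha : IsOuter a)
    (hle : ∀ᵐ θ ∂bMeasure, ‖bdry a θ‖ ≤ 1)
    (hL : Integrable (fun θ => Real.log ‖bdry a θ‖) bMeasure) {g : ℂ → ℂ} (hg : MemH2 g)
    (h0 : ∀ z ∈ unitDisk, avg (fun θ => (starRingEnd ℂ) (bdry a θ) * bdry g θ * szk z θ) = 0)
    {w : ℂ} (hw : w ∈ unitDisk) : g w = 0 := by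
  obtain ⟨c, hc, φ, hφ, hle1, hlim⟩ := ha.exists_approx hle hL
  have haH : MemHinf a := ⟨ha.1, 1, fun z hz => ha.norm_le_one hle hz⟩
  have hψ : ∀ n, MemHinf fun z => a z * φ n z := fun n => haH.mul (hφ n)
  have hgs : MemLp (fun θ => bdry g θ * szk w θ) 2 bMeasure := by
    have := hg.memLp_bdry.bdd_mul_two (continuous_szk hw).aestronglyMeasurable
      (ae_of_all _ (norm_szk_le hw))
    simpa only [mul_comm] using this
  have hort : ∀ n, avg (fun θ => (bdry g θ * szk w θ) *
      (starRingEnd ℂ) (bdry (fun z => a z * φ n z) θ)) = 0 := by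
    intro n
    have := avg_mul_conj_eq_zero (haH.memLp_conj_mul hg.memLp_bdry) h0
      ((hφ n).mul (memHinf_szKernel hw))
    rw [← this]
    refine avg_congr ?_
    filter_upwards [bdry_mul haH.memH2 (hφ n).memH2,
      bdry_mul (hφ n).memH2 (memHinf_szKernel hw).memH2] with θ h1 h2
    rw [h1, h2, bdry_szKernel hw]
    simp only [map_mul, conj_conj]
    ring
  have hd : ∀ n, MemLp (fun θ => (starRingEnd ℂ) (c - bdry (fun z => a z * φ n z) θ)) 2
      bMeasure := fun n => ((memLp_const c).sub (hψ n).memH2.memLp_bdry).conj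
  have hdn : ∀ n, ∫ θ, ‖(starRingEnd ℂ) (c - bdry (fun z => a z * φ n z) θ)‖ ^ 2 ∂bMeasure ≤
      2 * Real.pi * (2 - 2 * ((starRingEnd ℂ) c * (a 0 * φ n 0)).re) := by
    intro n
    set ψ := fun z => a z * φ n z with hψdef
    have hb : ∀ᵐ θ ∂bMeasure, ‖bdry ψ θ‖ ≤ 1 := by
      filter_upwards [(hψ n).memH2.tendsto_bdry] with θ h
      refine le_of_tendsto h.norm ?_
      filter_upwards [eventually_radial_mem θ] with r hr
      exact hle1 n _ hr
    have hi : Integrable (fun θ => (starRingEnd ℂ) c * bdry ψ θ) bMeasure :=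
      (hψ n).memH2.memLp_bdry.integrable_two.const_mul _
    have hir : Integrable (fun θ => ((starRingEnd ℂ) c * bdry ψ θ).re) bMeasure := hi.re
    have hre : ∫ θ, ((starRingEnd ℂ) c * bdry ψ θ).re ∂bMeasure =
        2 * Real.pi * ((starRingEnd ℂ) c * (a 0 * φ n 0)).re := by
      have h1 := avg_re hi
      rw [avg_const_mul, (hψ n).memH2.avg_bdry] at h1
      have := Real.pi_pos
      rw [h1]
      field_simp
    calc _ ≤ ∫ θ, (2 - 2 * ((starRingEnd ℂ) c * bdry ψ θ).re) ∂bMeasure := by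
          refine integral_mono_ae ((hd n).integrable_norm_pow (by norm_num))
            ((integrable_const _).sub (hir.const_mul 2)) ?_
          filter_upwards [hb] with θ h
          have h1 : ‖c - bdry ψ θ‖ ^ 2 =
              ‖c‖ ^ 2 + ‖bdry ψ θ‖ ^ 2 - 2 * ((starRingEnd ℂ) c * bdry ψ θ).re := by
            simp only [← normSq_eq_norm_sq, normSq_apply, sub_re, sub_im, mul_re, conj_re, conj_im]
            ring
          simp only [RCLike.norm_conj]
          rw [h1, hc]
          nlinarith [norm_nonneg (bdry ψ θ)]
      _ = _ := by
          rw [integral_sub (integrable_const _) (hir.const_mul 2), integral_const_mul]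
          rw [hre, integral_const, bMeasure_real_univ]
          simp only [smul_eq_mul]
          ring
  have hval : ∀ n, avg (fun θ => (bdry g θ * szk w θ) *
      (starRingEnd ℂ) (c - bdry (fun z => a z * φ n z) θ)) = (starRingEnd ℂ) c * g w := by
    intro n
    have h1 : avg (fun θ => (bdry g θ * szk w θ) * (starRingEnd ℂ) c) =
        (starRingEnd ℂ) c * g w := by
      rw [avg_mul_const, hg.avg_mul_szk hw, mul_comm]
    rw [← h1, ← sub_zero (avg fun θ => (bdry g θ * szk w θ) * (starRingEnd ℂ) c), ← hort n,
      ← avg_sub (hgs.integrable_two.mul_const _)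
        (hgs.integrable_mul_two (hψ n).memH2.memLp_bdry.conj)]
    simp only [map_sub, mul_sub]
  have hbound : ∀ n, ‖(starRingEnd ℂ) c * g w‖ ≤ (1 / (2 * Real.pi)) *
      (Real.sqrt (∫ θ, ‖bdry g θ * szk w θ‖ ^ 2 ∂bMeasure) *
        Real.sqrt (2 * Real.pi * (2 - 2 * ((starRingEnd ℂ) c * (a 0 * φ n 0)).re))) := by
    intro n
    rw [← hval n]
    refine (norm_avg_mul_le hgs (hd n)).trans ?_
    have := Real.pi_pos
    have := hdn n
    gcongr
  have hcc : (starRingEnd ℂ) c * c = 1 := by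
    rw [mul_comm, mul_conj, normSq_eq_norm_sq, hc]; simp
  have hto : Tendsto (fun n => (1 / (2 * Real.pi)) *
      (Real.sqrt (∫ θ, ‖bdry g θ * szk w θ‖ ^ 2 ∂bMeasure) *
        Real.sqrt (2 * Real.pi * (2 - 2 * ((starRingEnd ℂ) c * (a 0 * φ n 0)).re))))
      atTop (nhds 0) := by
    have h1 := (continuous_re.tendsto _).comp (hlim.const_mul ((starRingEnd ℂ) c))
    rw [hcc] at h1
    have h2 := ((Real.continuous_sqrt.tendsto _).comp
      (((h1.const_mul 2).const_sub 2).const_mul (2 * Real.pi))).const_mul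
      (Real.sqrt (∫ θ, ‖bdry g θ * szk w θ‖ ^ 2 ∂bMeasure)) |>.const_mul (1 / (2 * Real.pi))
    simpa [Function.comp_def] using h2
  have h3 := ge_of_tendsto' hto hbound
  rw [norm_le_zero_iff] at h3
  refine (mul_eq_zero.1 h3).resolve_left fun h4 => ?_
  rw [h4, zero_mul] at hcc
  exact zero_ne_one hcc

/-! ### Pairs -/

theorem IsPair.memHinf_left {b a : ℂ → ℂ} (h : IsPair b a) : MemHinf b :=
  ⟨h.1.1, 1, h.1.2.1⟩

theorem IsPair.norm_bdry_right_le {b a : ℂ → ℂ} (h : IsPair b a) :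
    ∀ᵐ θ ∂bMeasure, ‖bdry a θ‖ ≤ 1 := by
  filter_upwards [h.2.2] with θ h1
  nlinarith [sq_nonneg ‖bdry b θ‖, norm_nonneg (bdry a θ)]

theorem IsPair.memHinf_right {b a : ℂ → ℂ} (h : IsPair b a) : MemHinf a :=
  ⟨h.2.1.1, 1, fun _ hz => h.2.1.norm_le_one h.norm_bdry_right_le hz⟩

theorem IsPair.integrable_log {b a : ℂ → ℂ} (h : IsPair b a) :
    Integrable (fun θ => Real.log ‖bdry a θ‖) bMeasure := by
  refine (h.1.2.2.abs.add (integrable_const (Real.log 2))).mono' ?_ ?_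
  · exact (Real.measurable_log.comp_aemeasurable
      h.memHinf_right.memH2.memLp_bdry.1.norm.aemeasurable).aestronglyMeasurable
  · filter_upwards [h.2.2] with θ h1
    change _ ≤ |Real.log (1 - ‖bdry b θ‖)| + Real.log 2
    have hlog2 : 0 ≤ Real.log 2 := Real.log_nonneg one_le_two
    have hb1 : ‖bdry b θ‖ ≤ 1 := by
      nlinarith [sq_nonneg ‖bdry a θ‖, norm_nonneg (bdry b θ)]
    rcases hb1.eq_or_lt with h2 | h2
    · have : ‖bdry a θ‖ = 0 := by
        rw [h2] at h1
        exact pow_eq_zero_iff two_ne_zero |>.1 (by linarith)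
      rw [this, Real.log_zero, norm_zero]
      positivity
    · have h3 : ‖bdry a θ‖ ^ 2 = (1 - ‖bdry b θ‖) * (1 + ‖bdry b θ‖) := by linarith
      have h4 := congrArg Real.log h3
      have h5 := norm_nonneg (bdry b θ)
      rw [Real.log_pow, Real.log_mul (by linarith) (by linarith)] at h4
      have h6 : Real.log (1 + ‖bdry b θ‖) ≤ Real.log 2 := Real.log_le_log (by linarith) (by linarith)
      have h7 : 0 ≤ Real.log (1 + ‖bdry b θ‖) := Real.log_nonneg (by linarith)
      push_cast at h4
      rw [Real.norm_eq_abs]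
      have h8 := abs_le.1 (le_refl |Real.log (1 - ‖bdry b θ‖)|)
      rw [abs_le]
      constructor <;> linarith [h8.1, h8.2, abs_nonneg (Real.log (1 - ‖bdry b θ‖))]

theorem IsPair.eq_zero_of_avg {b a : ℂ → ℂ} (h : IsPair b a) {g : ℂ → ℂ} (hg : MemH2 g)
    (h0 : ∀ z ∈ unitDisk, avg (fun θ => (starRingEnd ℂ) (bdry a θ) * bdry g θ * szk z θ) = 0)
    {w : ℂ} (hw : w ∈ unitDisk) : g w = 0 :=
  h.2.1.eq_zero_of_avg h.norm_bdry_right_le h.integrable_log hg h0 hw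

/-! ### The space `H(b)` -/

/-- The relation `T_b̄ h = T_ā p` between `h ∈ H(b)` and `p = h⁺`. -/
def IsPlus (b a h p : ℂ → ℂ) : Prop :=
  MemH2 p ∧ ∀ z ∈ unitDisk, toeplitz (conjBdry b) h z = toeplitz (conjBdry a) p z

/-- The boundary function `b̄ h - ā p`. -/
def plusDefect (b a h p : ℂ → ℂ) (θ : ℝ) : ℂ :=
  (starRingEnd ℂ) (bdry b θ) * bdry h θ - (starRingEnd ℂ) (bdry a θ) * bdry p θ

theorem IsPlus.memHb {b a h p : ℂ → ℂ} (hh : MemH2 h) (hp : IsPlus b a h p) : MemHb b a h :=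
  ⟨hh, p, hp⟩

theorem MemHb.isPlus_plusFun {b a h : ℂ → ℂ} (hh : MemHb b a h) :
    IsPlus b a h (plusFun b a h) := Classical.epsilon_spec hh.2

theorem memLp_plusDefect {b a h p : ℂ → ℂ} (hpair : IsPair b a) (hh : MemH2 h) (hp : MemH2 p) :
    MemLp (plusDefect b a h p) 2 bMeasure :=
  (hpair.memHinf_left.memLp_conj_mul hh.memLp_bdry).sub
    (hpair.memHinf_right.memLp_conj_mul hp.memLp_bdry)

theorem avg_plusDefect_mul_szk {b a h p : ℂ → ℂ} (hpair : IsPair b a) (hh : MemH2 h)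
    (hp : MemH2 p) {z : ℂ} (hz : z ∈ unitDisk) :
    avg (fun θ => plusDefect b a h p θ * szk z θ) =
      toeplitz (conjBdry b) h z - toeplitz (conjBdry a) p z := by
  rw [toeplitz, toeplitz, szProj_eq_avg, szProj_eq_avg, ← avg_sub]
  · simp only [plusDefect, conjBdry, sub_mul]
  · exact (hpair.memHinf_left.memLp_conj_mul hh.memLp_bdry).integrable_mul_two (memLp_szk hz)
  · exact (hpair.memHinf_right.memLp_conj_mul hp.memLp_bdry).integrable_mul_two (memLp_szk hz)

theorem isPlus_iff {b a h p : ℂ → ℂ} (hpair : IsPair b a) (hh : MemH2 h) :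
    IsPlus b a h p ↔ MemH2 p ∧
      ∀ z ∈ unitDisk, avg (fun θ => plusDefect b a h p θ * szk z θ) = 0 := by
  refine and_congr_right fun hp => forall₂_congr fun z hz => ?_
  rw [avg_plusDefect_mul_szk hpair hh hp hz, sub_eq_zero]

theorem IsPlus.eqOn {b a h h' p q : ℂ → ℂ} (hpair : IsPair b a) (hp : IsPlus b a h p)
    (hq : IsPlus b a h' q) (hhh : ∀ z ∈ unitDisk, h z = h' z) {w : ℂ} (hw : w ∈ unitDisk) :
    p w = q w := by
  have hpq : MemH2 fun z => p z + (-1) * q z := hp.1.add (hq.1.const_mul (-1))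
  have h0 := hpair.eq_zero_of_avg hpq (fun z hz => ?_) hw
  · linear_combination h0
  · have h1 := hp.2 z hz
    have h2 := hq.2 z hz
    have h3 : toeplitz (conjBdry b) h z = toeplitz (conjBdry b) h' z := by
      rw [toeplitz, bdry_congr hhh, toeplitz]
    rw [h3, h2, toeplitz, toeplitz, szProj_eq_avg, szProj_eq_avg] at h1
    rw [← sub_eq_zero.2 h1.symm, ← avg_sub]
    · refine avg_congr ?_
      filter_upwards [bdry_add hp.1 (hq.1.const_mul (-1)), bdry_const_mul hq.1 (-1)] with θ h4 h5
      rw [h4, h5]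
      simp only [conjBdry]
      ring
    · exact (hpair.memHinf_right.memLp_conj_mul hp.1.memLp_bdry).integrable_mul_two (memLp_szk hz)
    · exact (hpair.memHinf_right.memLp_conj_mul hq.1.memLp_bdry).integrable_mul_two (memLp_szk hz)

theorem hbInner_eq {b a h g p q : ℂ → ℂ} (hpair : IsPair b a) (hp : IsPlus b a h p)
    (hq : IsPlus b a g q) (hh : MemH2 h) (hg : MemH2 g) :
    hbInner b a h g = bInner h g + bInner p q := by
  have h1 := bdry_congr fun z hz =>
    IsPlus.eqOn hpair (hp.memHb hh).isPlus_plusFun hp (fun _ _ => rfl) hz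
  have h2 := bdry_congr fun z hz =>
    IsPlus.eqOn hpair (hq.memHb hg).isPlus_plusFun hq (fun _ _ => rfl) hz
  rw [hbInner, bInner_eq_avg (plusFun _ _ _), h1, h2, ← bInner_eq_avg]

theorem hbKernel_eq (b : ℂ → ℂ) (w z : ℂ) :
    hbKernel b w z = (1 - (starRingEnd ℂ) (b w) * b z) * szKernel w z := by
  rw [hbKernel, szKernel, div_eq_mul_inv]

theorem memH2_hbKernel {b : ℂ → ℂ} (hb : MemHinf b) {w : ℂ} (hw : w ∈ unitDisk) :
    MemH2 (hbKernel b w) :=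
  ((((memHinf_const 1).sub ((memHinf_const _).mul hb)).mul (memHinf_szKernel hw)).memH2).congr
    fun z _ => hbKernel_eq b w z

theorem bdry_hbKernel {b : ℂ → ℂ} (hb : MemHinf b) {w : ℂ} (hw : w ∈ unitDisk) :
    ∀ᵐ θ ∂bMeasure, bdry (hbKernel b w) θ =
      (1 - (starRingEnd ℂ) (b w) * bdry b θ) * (starRingEnd ℂ) (szk w θ) := by
  filter_upwards [hb.memH2.tendsto_bdry, (memHinf_szKernel hw).memH2.tendsto_bdry] with θ h1 h2
  rw [← bdry_szKernel hw]
  refine bdry_eq_of_tendsto ?_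
  simp only [hbKernel_eq]
  exact (tendsto_const_nhds.sub (tendsto_const_nhds.mul h1)).mul h2

theorem memH2_plus_hbKernel {a : ℂ → ℂ} (ha : MemHinf a) {w : ℂ} (hw : w ∈ unitDisk) (c : ℂ) :
    MemH2 fun z => c * (a z * szKernel w z) :=
  ((memHinf_const c).mul (ha.mul (memHinf_szKernel hw))).memH2

theorem bdry_plus_hbKernel {a : ℂ → ℂ} (ha : MemHinf a) {w : ℂ} (hw : w ∈ unitDisk) (c : ℂ) :
    ∀ᵐ θ ∂bMeasure, bdry (fun z => c * (a z * szKernel w z)) θ =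
      c * (bdry a θ * (starRingEnd ℂ) (szk w θ)) := by
  filter_upwards [bdry_const_mul (ha.mul (memHinf_szKernel hw)).memH2 c,
    bdry_mul ha.memH2 (memHinf_szKernel hw).memH2] with θ h1 h2
  rw [h1, h2, bdry_szKernel hw]

theorem IsPair.conj_mul_add {b a : ℂ → ℂ} (h : IsPair b a) : ∀ᵐ θ ∂bMeasure,
    (starRingEnd ℂ) (bdry a θ) * bdry a θ + (starRingEnd ℂ) (bdry b θ) * bdry b θ = 1 := by
  filter_upwards [h.2.2] with θ h1
  rw [mul_comm, mul_conj, mul_comm _ (bdry b θ), mul_conj, normSq_eq_norm_sq, normSq_eq_norm_sq]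
  exact_mod_cast h1

theorem isPlus_hbKernel {b a : ℂ → ℂ} (hpair : IsPair b a) {w : ℂ} (hw : w ∈ unitDisk) :
    IsPlus b a (hbKernel b w) fun z => (starRingEnd ℂ) (b w) * (a z * szKernel w z) := by
  have hb := hpair.memHinf_left
  have ha := hpair.memHinf_right
  rw [isPlus_iff hpair (memH2_hbKernel hb hw)]
  refine ⟨memH2_plus_hbKernel ha hw _, fun z hz => ?_⟩
  have h1 := avg_conj_bdry_mul hb hw hz
  have h2 := (memHinf_szKernel hw).memH2.avg_mul_szk hz
  have h3 : avg (fun θ => (starRingEnd ℂ) (bdry b θ) * bdry (szKernel w) θ * szk z θ) -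
      (starRingEnd ℂ) (b w) * avg (fun θ => bdry (szKernel w) θ * szk z θ) = 0 := by
    rw [h1, h2, sub_self]
  refine Eq.trans ?_ h3
  rw [← avg_const_mul, ← avg_sub]
  · refine avg_congr ?_
    filter_upwards [bdry_hbKernel hb hw, bdry_plus_hbKernel ha hw ((starRingEnd ℂ) (b w)),
      hpair.conj_mul_add] with θ h4 h5 h6
    rw [plusDefect, h4, h5, bdry_szKernel hw]
    linear_combination (-(starRingEnd ℂ) (b w) * (starRingEnd ℂ) (szk w θ) * szk z θ) * h6
  · exact (hb.memLp_conj_mul (memHinf_szKernel hw).memH2.memLp_bdry).integrable_mul_two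
      (memLp_szk hz)
  · exact ((memHinf_szKernel hw).memH2.memLp_bdry.integrable_mul_two (memLp_szk hz)).const_mul _

theorem IsPlus.shift {b a h p : ℂ → ℂ} (hpair : IsPair b a) (hh : MemH2 h)
    (hp : IsPlus b a h p) :
    IsPlus b a (fun z => z * h z) fun z =>
      z * p z + avg (fun θ => uc θ * plusDefect b a h p θ) / (starRingEnd ℂ) (a 0) := by
  have ha := hpair.memHinf_right
  have ha0 : (starRingEnd ℂ) (a 0) ≠ 0 :=
    (map_ne_zero _).2 (hpair.2.1.ne_zero zero_mem_unitDisk)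
  have hzh : MemH2 fun z => z * h z := memHinf_id.mul_memH2 hh
  have hzp : MemH2 fun z => z * p z := memHinf_id.mul_memH2 hp.1
  set m := avg (fun θ => uc θ * plusDefect b a h p θ) with hm
  have hu := memLp_plusDefect hpair hh hp.1
  rw [isPlus_iff hpair hzh]
  refine ⟨hzp.add (memH2_const _), fun z hz => ?_⟩
  have h1 := szProj_uc_mul hu hz
  rw [((isPlus_iff hpair hh).1 hp).2 z hz, mul_zero, zero_add, ← hm] at h1
  have h2 := avg_conj_bdry_mul_szk ha hz
  have h3 : avg (fun θ => uc θ * plusDefect b a h p θ * szk z θ) -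
      m / (starRingEnd ℂ) (a 0) * avg (fun θ => (starRingEnd ℂ) (bdry a θ) * szk z θ) = 0 := by
    rw [h1, h2]
    field_simp
    ring
  refine Eq.trans ?_ h3
  rw [← avg_const_mul, ← avg_sub]
  · refine avg_congr ?_
    filter_upwards [bdry_mul_id hh, bdry_mul_id hp.1,
      bdry_add hzp (memH2_const (m / (starRingEnd ℂ) (a 0)))] with θ h4 h5 h6
    rw [plusDefect, plusDefect, h4, h6, h5, bdry_const]
    ring
  · exact (memLp_uc_mul hu).integrable_mul_two (memLp_szk hz)
  · exact (ha.memH2.memLp_bdry.conj.integrable_mul_two (memLp_szk hz)).const_mul _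

/-- The reproducing property of the kernels of `H(b)`. -/
theorem hbInner_hbKernel {b a h p : ℂ → ℂ} (hpair : IsPair b a) (hh : MemH2 h)
    (hp : IsPlus b a h p) {w : ℂ} (hw : w ∈ unitDisk) :
    hbInner b a h (hbKernel b w) = h w := by
  have hb := hpair.memHinf_left
  have ha := hpair.memHinf_right
  have hk := memH2_hbKernel hb hw
  have hq := isPlus_hbKernel hpair hw
  rw [hbInner_eq hpair hp hq hh hk, bInner_eq_avg, bInner_eq_avg, ← avg_add
    (hh.memLp_bdry.integrable_mul_two hk.memLp_bdry.conj)
    (hp.1.memLp_bdry.integrable_mul_two hq.1.memLp_bdry.conj)]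
  have h1 := ((isPlus_iff hpair hh).1 hp).2 w hw
  rw [← sub_zero (h w), ← mul_zero (b w), ← h1, ← avg_const_mul, ← hh.avg_mul_szk hw, ← avg_sub
    (hh.memLp_bdry.integrable_mul_two (memLp_szk hw))
    (((memLp_plusDefect hpair hh hp.1).integrable_mul_two (memLp_szk hw)).const_mul _)]
  refine avg_congr ?_
  filter_upwards [bdry_hbKernel hb hw, bdry_plus_hbKernel ha hw ((starRingEnd ℂ) (b w))]
    with θ h4 h5
  rw [h4, h5, plusDefect]
  simp only [map_mul, map_sub, map_one, conj_conj]
  ring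

/-- The inner product of `h ∈ H(b)` with `z k_w^b`. -/
theorem hbInner_mul_hbKernel {b a h p : ℂ → ℂ} (hpair : IsPair b a) (hh : MemH2 h)
    (hp : IsPlus b a h p) {w : ℂ} (hw : w ∈ unitDisk) :
    w * hbInner b a h (fun z => z * hbKernel b w z) =
      h w - h 0 + p 0 / a 0 * (b w - b 0) := by
  have hb := hpair.memHinf_left
  have ha := hpair.memHinf_right
  have ha0 : a 0 ≠ 0 := hpair.2.1.ne_zero zero_mem_unitDisk
  have hk := memH2_hbKernel hb hw
  have hq := isPlus_hbKernel hpair hw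
  have hzk : MemH2 fun z => z * hbKernel b w z := memHinf_id.mul_memH2 hk
  have hzq : MemH2 fun z => z * ((starRingEnd ℂ) (b w) * (a z * szKernel w z)) :=
    memHinf_id.mul_memH2 hq.1
  have hs := hq.shift hpair hk
  set q := fun z => (starRingEnd ℂ) (b w) * (a z * szKernel w z) with hqdef
  set m := avg (fun θ => uc θ * plusDefect b a (hbKernel b w) q θ) with hm
  have hd := memLp_plusDefect hpair hk hq.1
  have hu := memLp_plusDefect hpair hh hp.1
  have hu0 := ((isPlus_iff hpair hh).1 hp).2
  have hmval : w * (starRingEnd ℂ) m = b w - b 0 := by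
    have e1 : b w - b 0 - b w * (avg (szk w) - avg fun _ => 1) = b w - b 0 := by
      rw [avg_szk hw, avg_const]; ring
    rw [← e1, hm, ← avg_conj, ← avg_const_mul, ← avg_sub (memLp_szk hw).integrable_two
      (integrable_const _), ← avg_const_mul, ← hb.memH2.avg_mul_szk hw, ← hb.memH2.avg_bdry,
      ← avg_sub (hb.memH2.memLp_bdry.integrable_mul_two (memLp_szk hw))
        hb.memH2.memLp_bdry.integrable_two, ← avg_sub]
    · rw [hb.memH2.avg_mul_szk hw]
      refine avg_congr ?_
      filter_upwards [bdry_hbKernel hb hw, bdry_plus_hbKernel ha hw ((starRingEnd ℂ) (b w)),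
        hpair.conj_mul_add] with θ h4 h5 h6
      rw [plusDefect, h4, h5]
      simp only [map_mul, map_sub, map_one, conj_conj]
      have h7 := mul_conj_uc_mul_szk hw θ
      linear_combination (bdry b θ - b w) * h7 -
        b w * w * (starRingEnd ℂ) (uc θ) * szk w θ * h6
    · exact (hb.memH2.memLp_bdry.integrable_mul_two (memLp_szk hw)).sub
        hb.memH2.memLp_bdry.integrable_two
    · exact (((memLp_szk hw).integrable_two).sub (integrable_const _)).const_mul _
  have hu00 := hu0 0 zero_mem_unitDisk
  simp only [szk_zero, mul_one] at hu00
  have he0 : h w - h 0 = h w - h 0 - b w * (avg (fun θ => plusDefect b a h p θ * szk w θ) -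
      avg (plusDefect b a h p)) := by
    rw [hu0 w hw, hu00]; ring
  rw [hbInner_eq hpair hp hs hh hzk, bInner_eq_avg, bInner_eq_avg, ← avg_add
    (hh.memLp_bdry.integrable_mul_two hzk.memLp_bdry.conj)
    (hp.1.memLp_bdry.integrable_mul_two hs.1.memLp_bdry.conj), ← avg_const_mul, ← hmval,
    he0, ← hh.avg_mul_szk hw, ← hh.avg_bdry, ← hp.1.avg_bdry, ← avg_sub (hh.memLp_bdry.integrable_mul_two (memLp_szk hw)) hh.memLp_bdry.integrable_two,
    ← avg_sub (hu.integrable_mul_two (memLp_szk hw)) hu.integrable_two, ← avg_const_mul,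
    ← avg_sub]
  · have e2 : avg (bdry p) / a 0 * (w * (starRingEnd ℂ) m) =
        avg (fun θ => w * (starRingEnd ℂ) m / a 0 * bdry p θ) := by
      rw [avg_const_mul]; ring
    rw [e2, ← avg_add]
    · refine avg_congr ?_
      filter_upwards [bdry_hbKernel hb hw, bdry_plus_hbKernel ha hw ((starRingEnd ℂ) (b w)),
        bdry_mul_id hk, bdry_mul_id hq.1,
        bdry_add hzq (memH2_const (m / (starRingEnd ℂ) (a 0)))] with θ h1 h2 h3 h4 h5
      rw [h3, h1, h5, h4, h2, bdry_const, plusDefect]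
      simp only [map_mul, map_sub, map_one, conj_conj, map_add, map_div₀]
      have h7 := mul_conj_uc_mul_szk hw θ
      linear_combination (bdry h θ - b w * ((starRingEnd ℂ) (bdry b θ) * bdry h θ -
        (starRingEnd ℂ) (bdry a θ) * bdry p θ)) * h7
    · exact ((hh.memLp_bdry.integrable_mul_two (memLp_szk hw)).sub
        hh.memLp_bdry.integrable_two).sub (((hu.integrable_mul_two (memLp_szk hw)).sub
          hu.integrable_two).const_mul _)
    · exact hp.1.memLp_bdry.integrable_two.const_mul _
  · exact (hh.memLp_bdry.integrable_mul_two (memLp_szk hw)).sub hh.memLp_bdry.integrable_two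
  · exact ((hu.integrable_mul_two (memLp_szk hw)).sub hu.integrable_two).const_mul _

/-! ### Eigenvectors of `Y*` -/

theorem YstarEigen.mul_eq {b a : ℂ → ℂ} {z₀ : ℂ} {h : ℂ → ℂ} (hpair : IsPair b a)
    (heig : YstarEigen b a z₀ h) {w : ℂ} (hw : w ∈ unitDisk) :
    (1 - (starRingEnd ℂ) z₀ * w) * h w =
      h 0 + plusFun b a h 0 / a 0 * b 0 - plusFun b a h 0 / a 0 * b w := by
  have hp := heig.1.isPlus_plusFun
  have h1 := heig.2 (hbKernel b w)
    ((isPlus_hbKernel hpair hw).memHb (memH2_hbKernel hpair.memHinf_left hw))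
  have h2 := hbInner_mul_hbKernel hpair heig.1.1 hp hw
  rw [hbInner_hbKernel hpair heig.1.1 hp hw] at h1
  rw [h1] at h2
  linear_combination -h2

theorem memHinf_one_sub_conj_mul (z₀ : ℂ) : MemHinf fun z => 1 - (starRingEnd ℂ) z₀ * z :=
  (memHinf_const 1).sub ((memHinf_const _).mul memHinf_id)

theorem bdry_one_sub_conj_mul (z₀ : ℂ) (θ : ℝ) :
    bdry (fun z => 1 - (starRingEnd ℂ) z₀ * z) θ = 1 - (starRingEnd ℂ) z₀ * uc θ :=
  bdry_of_continuousAt (f := fun z => 1 - (starRingEnd ℂ) z₀ * z) (by fun_prop)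

theorem bdry_one_sub_conj_mul_mul (z₀ : ℂ) {f : ℂ → ℂ} (hf : MemH2 f) :
    ∀ᵐ θ ∂bMeasure, bdry (fun z => (1 - (starRingEnd ℂ) z₀ * z) * f z) θ =
      (1 - (starRingEnd ℂ) z₀ * uc θ) * bdry f θ := by
  filter_upwards [bdry_mul (memHinf_one_sub_conj_mul z₀).memH2 hf] with θ h
  rw [h, bdry_one_sub_conj_mul]

theorem bdry_const_sub_const_mul {f : ℂ → ℂ} (hf : MemH2 f) (c d : ℂ) :
    ∀ᵐ θ ∂bMeasure, bdry (fun z => c - d * f z) θ = c - d * bdry f θ := by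
  filter_upwards [hf.tendsto_bdry] with θ h
  exact bdry_eq_of_tendsto (tendsto_const_nhds.sub (tendsto_const_nhds.mul h))

theorem IsPlus.mul_eq {b a h p : ℂ → ℂ} (hpair : IsPair b a) (hh : MemH2 h)
    (hp : IsPlus b a h p) {z₀ A κ : ℂ}
    (hκ : κ = p 0 / a 0)
    (hA : ∀ w ∈ unitDisk, (1 - (starRingEnd ℂ) z₀ * w) * h w = A - κ * b w)
    {w : ℂ} (hw : w ∈ unitDisk) : (1 - (starRingEnd ℂ) z₀ * w) * p w = κ * a w := by
  have hb := hpair.memHinf_left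
  have ha := hpair.memHinf_right
  have ha0 : a 0 ≠ 0 := hpair.2.1.ne_zero zero_mem_unitDisk
  have ha0' : (starRingEnd ℂ) (a 0) ≠ 0 := (map_ne_zero _).2 ha0
  have hu := memLp_plusDefect hpair hh hp.1
  have hu0 := ((isPlus_iff hpair hh).1 hp).2
  set m := avg (fun θ => uc θ * plusDefect b a h p θ) with hm
  set M := (A * (starRingEnd ℂ) (b 0) - κ + (starRingEnd ℂ) z₀ * m) / (starRingEnd ℂ) (a 0)
    with hM
  have h1p : MemH2 fun z => (1 - (starRingEnd ℂ) z₀ * z) * p z :=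
    (memHinf_one_sub_conj_mul z₀).mul_memH2 hp.1
  have haM : MemH2 fun z => -M - κ * a z :=
    ((memHinf_const (-M)).sub ((memHinf_const κ).mul ha)).memH2
  have hG : ∀ z ∈ unitDisk, (1 - (starRingEnd ℂ) z₀ * z) * p z + (-M - κ * a z) = 0 := by
    intro v hv
    refine hpair.eq_zero_of_avg (h1p.add haM) (fun z hz => ?_) hv
    have e1 := avg_conj_bdry_mul_szk hb hz
    have e2 := avg_szk hz
    have e3 := szProj_uc_mul hu hz
    have e4 := avg_conj_bdry_mul_szk ha hz
    rw [hu0 z hz, mul_zero, zero_add, ← hm] at e3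
    have e5 : A * avg (fun θ => (starRingEnd ℂ) (bdry b θ) * szk z θ) - κ * avg (szk z) -
        avg (fun θ => plusDefect b a h p θ * szk z θ) +
        (starRingEnd ℂ) z₀ * avg (fun θ => uc θ * plusDefect b a h p θ * szk z θ) -
        M * avg (fun θ => (starRingEnd ℂ) (bdry a θ) * szk z θ) = 0 := by
      rw [e1, e2, e3, e4, hu0 z hz, hM]
      field_simp
      ring
    refine Eq.trans ?_ e5
    have i1 := (hb.memH2.memLp_bdry.conj.integrable_mul_two (memLp_szk hz)).const_mul A
    have i2 := (memLp_szk hz).integrable_two.const_mul κ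
    have i3 := hu.integrable_mul_two (memLp_szk hz)
    have i4 := ((memLp_uc_mul hu).integrable_mul_two (memLp_szk hz)).const_mul
      ((starRingEnd ℂ) z₀)
    have i5 := (ha.memH2.memLp_bdry.conj.integrable_mul_two (memLp_szk hz)).const_mul M
    have i12 : Integrable (fun θ => A * ((starRingEnd ℂ) (bdry b θ) * szk z θ) -
        κ * szk z θ) bMeasure := i1.sub i2
    have i123 : Integrable (fun θ => A * ((starRingEnd ℂ) (bdry b θ) * szk z θ) -
        κ * szk z θ - plusDefect b a h p θ * szk z θ) bMeasure := i12.sub i3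
    have i1234 : Integrable (fun θ => A * ((starRingEnd ℂ) (bdry b θ) * szk z θ) -
        κ * szk z θ - plusDefect b a h p θ * szk z θ +
        (starRingEnd ℂ) z₀ * (uc θ * plusDefect b a h p θ * szk z θ)) bMeasure := i123.add i4
    rw [← avg_const_mul, ← avg_const_mul, ← avg_const_mul, ← avg_const_mul, ← avg_sub i1 i2,
      ← avg_sub i12 i3, ← avg_add i123 i4, ← avg_sub i1234 i5]
    refine avg_congr ?_
    have hbd := bdry_congr hA
    filter_upwards [bdry_add h1p haM, bdry_one_sub_conj_mul_mul z₀ hp.1,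
      bdry_one_sub_conj_mul_mul z₀ hh, bdry_const_sub_const_mul ha.memH2 (-M) κ,
      bdry_const_sub_const_mul hb.memH2 A κ, hpair.conj_mul_add] with θ h1 h2 h3 h4 h5 h6
    rw [h1, h2, h4, plusDefect]
    rw [hbd, h5] at h3
    linear_combination (-κ * szk z θ) * h6 - (starRingEnd ℂ) (bdry b θ) * szk z θ * h3
  have h0 := hG 0 zero_mem_unitDisk
  have hκ0 : κ * a 0 = p 0 := by rw [hκ]; field_simp
  have hw0 := hG w hw
  linear_combination hw0 - h0 - hκ0

theorem exists_uc_eq {z : ℂ} (hz : ‖z‖ = 1) : ∃ θ ∈ Icc 0 (2 * Real.pi), uc θ = z := by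
  have h1 : uc z.arg = z := by
    have := norm_mul_exp_arg_mul_I z
    rwa [hz, ofReal_one, one_mul] at this
  have h2 := neg_pi_lt_arg z
  have h3 := arg_le_pi z
  rcases le_or_gt 0 z.arg with h | h
  · exact ⟨z.arg, ⟨h, by linarith⟩, h1⟩
  · refine ⟨z.arg + 2 * Real.pi, ⟨by linarith, by linarith⟩, ?_⟩
    unfold uc
    push_cast
    rw [add_mul, exp_add, exp_two_pi_mul_I, mul_one]
    exact h1

theorem ae_uc_ne (θ₀ : ℝ) : ∀ᵐ θ ∂bMeasure, uc θ ≠ uc θ₀ := by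
  refine ae_restrict_of_ae ?_
  have hc : (range fun n : ℤ => θ₀ + n * (2 * Real.pi)).Countable := countable_range _
  filter_upwards [hc.ae_notMem volume] with θ hθ h
  obtain ⟨n, hn⟩ := exp_eq_exp_iff_exists_int.1 h
  refine hθ ⟨n, ?_⟩
  have h1 : (θ : ℂ) = θ₀ + n * (2 * Real.pi) := by
    refine mul_right_cancel₀ I_ne_zero ?_
    linear_combination hn
  exact_mod_cast h1.symm

/-- Functions in `H²` are `o((1 - r)⁻¹)` along every radius. -/
theorem MemH2.tendsto_one_sub_mul {f : ℂ → ℂ} (hf : MemH2 f) (θ₀ : ℝ) :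
    Tendsto (fun r : ℝ => ((1 - r : ℝ) : ℂ) * f (r * uc θ₀)) (nhdsWithin 1 (Iio 1))
      (nhds 0) := by
  have hlim : Tendsto (fun r : ℝ => ∫ θ, bdry f θ * (((1 - r : ℝ) : ℂ) * szk (r * uc θ₀) θ)
      ∂bMeasure) (nhdsWithin 1 (Iio 1)) (nhds (∫ θ, bdry f θ * 0 ∂bMeasure)) := by
    refine tendsto_integral_filter_of_dominated_convergence (fun θ => ‖bdry f θ‖) ?_ ?_
      hf.memLp_bdry.integrable_two.norm ?_
    · filter_upwards [eventually_mem_Ico] with r hr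
      exact hf.memLp_bdry.1.mul
        ((continuous_szk (radial_mem hr.1 hr.2 θ₀)).const_mul _).aestronglyMeasurable
    · filter_upwards [eventually_mem_Ico] with r hr
      refine ae_of_all _ fun θ => ?_
      have h1 := norm_szk_le (radial_mem hr.1 hr.2 θ₀) θ
      rw [norm_radial hr.1] at h1
      have h2 : 0 < 1 - r := by linarith [hr.2]
      rw [norm_mul, norm_mul, norm_real, Real.norm_of_nonneg h2.le]
      have h3 : (1 - r) * ‖szk (r * uc θ₀) θ‖ ≤ 1 := by
        calc _ ≤ (1 - r) * (1 - r)⁻¹ := by gcongr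
          _ = 1 := mul_inv_cancel₀ h2.ne'
      exact mul_le_of_le_one_right (norm_nonneg _) h3
    · filter_upwards [ae_uc_ne θ₀] with θ hθ
      refine tendsto_const_nhds.mul ?_
      have hne : uc θ - ((1 : ℝ) : ℂ) * uc θ₀ ≠ 0 := by
        rw [ofReal_one, one_mul]; exact sub_ne_zero.2 hθ
      have hcont : ContinuousAt (fun r : ℝ => ((1 - r : ℝ) : ℂ) * (uc θ / (uc θ - r * uc θ₀))) 1 :=
        ContinuousAt.mul (by fun_prop) (ContinuousAt.div (by fun_prop) (by fun_prop) hne)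
      have := tendsto_nhdsWithin_of_tendsto_nhds (s := Iio 1) hcont.tendsto
      simpa [szk_eq] using this
  have h2 := hlim.const_mul (1 / (2 * (Real.pi : ℂ)))
  simp only [mul_zero, integral_zero] at h2
  refine h2.congr' ?_
  filter_upwards [eventually_mem_Ico] with r hr
  rw [← hf.avg_mul_szk (radial_mem hr.1 hr.2 θ₀), ← avg_const_mul, avg]
  refine congrArg _ (integral_congr_ae (ae_of_all _ fun θ => ?_))
  ring

theorem conj_uc_mul_self (θ : ℝ) : (starRingEnd ℂ) (uc θ) * uc θ = 1 := by
  rw [conj_uc, inv_mul_cancel₀ (uc_ne_zero θ)]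

theorem norm_one_sub_conj_uc_mul (θ₀ θ : ℝ) :
    ‖1 - (starRingEnd ℂ) (uc θ₀) * uc θ‖ ≤ |θ - θ₀| := by
  have : 1 - (starRingEnd ℂ) (uc θ₀) * uc θ = -((starRingEnd ℂ) (uc θ₀) * (uc θ - uc θ₀)) := by
    linear_combination -(conj_uc_mul_self θ₀)
  rw [this, norm_neg, norm_mul, RCLike.norm_conj, norm_uc, one_mul]
  exact norm_uc_sub_uc_le θ θ₀

/-- If `(1 - z̄₀ z) h = κ (A - b)` and `(1 - z̄₀ z) p = κ a` with `h, p ∈ H²`, then `|A| = 1`. -/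
theorem norm_eq_one_of_mul_eq {b a h p : ℂ → ℂ} (hpair : IsPair b a) (hh : MemH2 h)
    (hp : MemH2 p) {θ₀ : ℝ} (hθ₀ : θ₀ ∈ Icc 0 (2 * Real.pi)) {A κ : ℂ} (hκ : κ ≠ 0)
    (hA : ∀ w ∈ unitDisk, (1 - (starRingEnd ℂ) (uc θ₀) * w) * h w = κ * A - κ * b w)
    (hP : ∀ w ∈ unitDisk, (1 - (starRingEnd ℂ) (uc θ₀) * w) * p w = κ * a w) : ‖A‖ = 1 := by
  have hb := hpair.memHinf_left
  have ha := hpair.memHinf_right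
  by_contra hne
  set δ := |1 - ‖A‖ ^ 2| with hδ
  have hδ0 : 0 < δ := by
    rw [hδ, abs_pos, sub_ne_zero]
    intro h1
    exact hne ((sq_eq_sq₀ (norm_nonneg A) zero_le_one).1 (by rw [one_pow, h1]))
  set C := (1 + ‖A‖) / ‖κ‖ with hC
  have hκ' : 0 < ‖κ‖ := norm_pos_iff.2 hκ
  have hbound : ∀ᵐ θ ∂bMeasure, δ ≤ C * |θ - θ₀| * (‖bdry h θ‖ + ‖bdry p θ‖) := by
    have hbd := bdry_congr hA
    have hbd' := bdry_congr hP
    filter_upwards [bdry_one_sub_conj_mul_mul (uc θ₀) hh, bdry_one_sub_conj_mul_mul (uc θ₀) hp,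
      bdry_const_sub_const_mul hb.memH2 (κ * A) κ, bdry_const_mul ha.memH2 κ, hpair.2.2]
      with θ h1 h2 h3 h4 h5
    rw [hbd, h3] at h1
    rw [hbd', h4] at h2
    have hn := norm_one_sub_conj_uc_mul θ₀ θ
    have n1 : ‖κ‖ * ‖A - bdry b θ‖ ≤ |θ - θ₀| * ‖bdry h θ‖ := by
      rw [← norm_mul, mul_sub, h1, norm_mul]
      gcongr
    have n2 : ‖κ‖ * ‖bdry a θ‖ ≤ |θ - θ₀| * ‖bdry p θ‖ := by
      rw [← norm_mul, h2, norm_mul]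
      gcongr
    have hb1 : ‖bdry b θ‖ ≤ 1 := by
      nlinarith [sq_nonneg ‖bdry a θ‖, norm_nonneg (bdry b θ)]
    have ha1 : ‖bdry a θ‖ ≤ 1 := by
      nlinarith [sq_nonneg ‖bdry b θ‖, norm_nonneg (bdry a θ)]
    have n3 : δ ≤ ‖bdry a θ‖ + ‖A - bdry b θ‖ * (1 + ‖A‖) := by
      have e1 : 1 - ‖A‖ ^ 2 = ‖bdry a θ‖ ^ 2 +
          (‖bdry b θ‖ - ‖A‖) * (‖bdry b θ‖ + ‖A‖) := by rw [← h5]; ring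
      have e2 : |‖bdry b θ‖ - ‖A‖| ≤ ‖A - bdry b θ‖ := by
        rw [norm_sub_rev]; exact abs_norm_sub_norm_le _ _
      rw [hδ, e1]
      refine (abs_add_le _ _).trans (add_le_add ?_ ?_)
      · rw [abs_of_nonneg (by positivity)]
        nlinarith [norm_nonneg (bdry a θ)]
      · rw [abs_mul, abs_of_nonneg (a := ‖bdry b θ‖ + ‖A‖) (by positivity)]
        gcongr
    have e3 : C * |θ - θ₀| * (‖bdry h θ‖ + ‖bdry p θ‖) =
        (1 + ‖A‖) * (|θ - θ₀| * ‖bdry h θ‖ + |θ - θ₀| * ‖bdry p θ‖) / ‖κ‖ := by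
      rw [hC]; ring
    rw [e3, le_div_iff₀ hκ']
    have := norm_nonneg A
    have := norm_nonneg (bdry a θ)
    have := mul_nonneg (norm_nonneg A) (mul_nonneg hκ'.le (norm_nonneg (bdry a θ)))
    calc δ * ‖κ‖ ≤ (‖bdry a θ‖ + ‖A - bdry b θ‖ * (1 + ‖A‖)) * ‖κ‖ := by gcongr
      _ ≤ (1 + ‖A‖) * (‖κ‖ * ‖A - bdry b θ‖ + ‖κ‖ * ‖bdry a θ‖) := by nlinarith
      _ ≤ _ := by gcongr
  have hint : IntervalIntegrable (fun θ : ℝ => (θ - θ₀)⁻¹) volume 0 (2 * Real.pi) := by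
    rw [intervalIntegrable_iff, uIoc_of_le Real.two_pi_pos.le]
    have hi : Integrable (fun θ => C / δ * (‖bdry h θ‖ + ‖bdry p θ‖)) bMeasure :=
      (hh.memLp_bdry.integrable_two.norm.add hp.memLp_bdry.integrable_two.norm).const_mul _
    refine hi.mono' (by fun_prop) ?_
    filter_upwards [hbound] with θ h1
    rcases eq_or_ne θ θ₀ with rfl | h2
    · rw [sub_self, inv_zero, norm_zero]
      positivity
    · have h3 : 0 < |θ - θ₀| := abs_pos.2 (sub_ne_zero.2 h2)
      rw [norm_inv, Real.norm_eq_abs, inv_le_iff_one_le_mul₀ h3, div_mul_eq_mul_div,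
        div_mul_eq_mul_div, le_div_iff₀ hδ0]
      linarith
  rw [intervalIntegrable_sub_inv_iff] at hint
  rcases hint with h1 | h1
  · exact Real.two_pi_pos.ne h1
  · exact h1 (by rwa [uIcc_of_le Real.two_pi_pos.le])

/-- Every eigenvector of `Y*` is a multiple of the boundary kernel. -/
theorem YstarEigen.exists_eq {b a : ℂ → ℂ} {z₀ : ℂ} {h : ℂ → ℂ} (hpair : IsPair b a)
    (hz₀ : ‖z₀‖ = 1) (heig : YstarEigen b a z₀ h) :
    ∃ c : ℂ, ∀ z ∈ unitDisk, h z = c * hbBoundaryKernel b z₀ z := by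
  obtain ⟨θ₀, hθ₀, rfl⟩ := exists_uc_eq hz₀
  have hp := heig.1.isPlus_plusFun
  set κ := plusFun b a h 0 / a 0 with hκ
  have hA : ∀ w ∈ unitDisk, (1 - (starRingEnd ℂ) (uc θ₀) * w) * h w =
      (h 0 + κ * b 0) - κ * b w := fun w hw => heig.mul_eq hpair hw
  have hP : ∀ w ∈ unitDisk, (1 - (starRingEnd ℂ) (uc θ₀) * w) * plusFun b a h w = κ * a w :=
    fun w hw => hp.mul_eq hpair heig.1.1 hκ hA hw
  have hlim : Tendsto (fun r : ℝ => (h 0 + κ * b 0) - κ * b (r * uc θ₀))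
      (nhdsWithin 1 (Iio 1)) (nhds 0) := by
    refine (heig.1.1.tendsto_one_sub_mul θ₀).congr' ?_
    filter_upwards [eventually_radial_mem θ₀] with r hr
    rw [← hA _ hr]
    push_cast
    linear_combination (r : ℂ) * h (r * uc θ₀) * conj_uc_mul_self θ₀
  have hne : ∀ z ∈ unitDisk, 1 - (starRingEnd ℂ) (uc θ₀) * z ≠ 0 := fun z hz =>
    one_sub_conj_mul_ne_zero (norm_uc θ₀).le hz
  rcases eq_or_ne κ 0 with h0 | h0
  · refine ⟨0, fun z hz => ?_⟩
    have h1 := hA z hz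
    simp only [h0, zero_mul, add_zero, sub_zero] at hlim h1
    rw [tendsto_nhds_unique tendsto_const_nhds hlim] at h1
    rw [(mul_eq_zero.1 h1).resolve_left (hne z hz), zero_mul]
  · set A := (h 0 + κ * b 0) / κ with hAdef
    have hκA : h 0 + κ * b 0 = κ * A := by rw [hAdef]; field_simp
    rw [hκA] at hA hlim
    have hlim2 : Tendsto (fun r : ℝ => b (r * uc θ₀)) (nhdsWithin 1 (Iio 1)) (nhds A) := by
      have h1 := (hlim.const_mul κ⁻¹).const_sub A
      rw [mul_zero, sub_zero] at h1
      refine h1.congr fun r => ?_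
      field_simp
      ring
    have hrad : radLim b (uc θ₀) = A := bdry_eq_of_tendsto hlim2
    have hA1 := norm_eq_one_of_mul_eq hpair heig.1.1 hp.1 hθ₀ h0 hA hP
    have hAA : A * (starRingEnd ℂ) A = 1 := by
      rw [mul_conj, normSq_eq_norm_sq, hA1]; simp
    refine ⟨κ * A, fun z hz => ?_⟩
    rw [hbBoundaryKernel, hrad, mul_div_assoc', eq_div_iff (hne z hz), mul_comm (h z), hA z hz]
    linear_combination κ * b z * hAA

theorem bInner_const_mul_left {f : ℂ → ℂ} (hf : MemH2 f) (c : ℂ) (g : ℂ → ℂ) :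
    bInner (fun z => c * f z) g = c * bInner f g := by
  rw [bInner_eq_avg, bInner_eq_avg, ← avg_const_mul]
  refine avg_congr ?_
  filter_upwards [bdry_const_mul hf c] with θ h
  rw [h, mul_assoc]

theorem IsPlus.const_mul {b a h p : ℂ → ℂ} (hh : MemH2 h) (hp : IsPlus b a h p) (c : ℂ) :
    IsPlus b a (fun z => c * h z) fun z => c * p z := by
  refine ⟨hp.1.const_mul c, fun z hz => ?_⟩
  have key : ∀ (φ : ℝ → ℂ) {f : ℂ → ℂ}, MemH2 f →
      toeplitz φ (fun z => c * f z) z = c * toeplitz φ f z := by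
    intro φ f hf
    rw [toeplitz, toeplitz, szProj_eq_avg, szProj_eq_avg, ← avg_const_mul]
    refine avg_congr ?_
    filter_upwards [bdry_const_mul hf c] with θ h
    rw [h]
    ring
  rw [key _ hh, key _ hp.1, hp.2 z hz]

theorem YstarEigen.const_mul {b a : ℂ → ℂ} {z₀ : ℂ} {h : ℂ → ℂ} (hpair : IsPair b a)
    (heig : YstarEigen b a z₀ h) (c : ℂ) {f : ℂ → ℂ}
    (hf : ∀ z ∈ unitDisk, f z = c * h z) : YstarEigen b a z₀ f := by
  have hp := heig.1.isPlus_plusFun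
  have hcp := hp.const_mul heig.1.1 c
  have hfH : MemH2 f := (heig.1.1.const_mul c).congr hf
  have hfp : IsPlus b a f fun z => c * plusFun b a h z := by
    refine ⟨hcp.1, fun z hz => ?_⟩
    rw [← hcp.2 z hz, toeplitz, toeplitz, bdry_congr hf]
  have hin : ∀ g, MemHb b a g → hbInner b a f g = c * hbInner b a h g := by
    intro g hg
    rw [hbInner_eq hpair hfp hg.isPlus_plusFun hfH hg.1, bInner_const_mul_left hp.1,
      bInner_eq_avg f, bdry_congr hf, ← bInner_eq_avg, bInner_const_mul_left heig.1.1, hbInner,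
      mul_add]
  refine ⟨hfp.memHb hfH, fun g hg => ?_⟩
  have hzg : MemHb b a fun z => z * g z :=
    (hg.isPlus_plusFun.shift hpair hg.1).memHb (memHinf_id.mul_memH2 hg.1)
  rw [hin g hg, hin _ hzg, heig.2 g hg]
  ring

/-- Theorem 3.  Let `b` be nonextreme with pair `(b, a)`, let
`z₀ ∈ ∂𝔻`, and let `λ ∈ ∂𝔻` be such that the Herglotz measure `μ_λ` is absolutely
continuous.  If `conj z₀` is an eigenvalue of `Y*`, then `ker (Y* − conj z₀)` is one
dimensional, spanned by the boundary kernel `k_{z₀}^b`. -/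
theorem Ystar_eigenspace_spanned_by_boundary_kernel (b a : ℂ → ℂ) (z₀ lam : ℂ)
    (hpair : IsPair b a) (hz₀ : ‖z₀‖ = 1) (hlam : ‖lam‖ = 1)
    (hac : HerglotzAC b a lam)
    (heig : ∃ h : ℂ → ℂ, YstarEigen b a z₀ h ∧ ¬ ∀ z ∈ unitDisk, h z = 0) :
    {h : ℂ → ℂ | YstarEigen b a z₀ h} =
      {h : ℂ → ℂ | ∃ c : ℂ, ∀ z ∈ unitDisk, h z = c * hbBoundaryKernel b z₀ z} := by
  obtain ⟨h₀, hh₀, hne⟩ := heig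
  ext f
  refine ⟨fun hf => YstarEigen.exists_eq hpair hz₀ hf, ?_⟩
  rintro ⟨c, hc⟩
  obtain ⟨c₀, hc₀⟩ := hh₀.exists_eq hpair hz₀
  have hc₀0 : c₀ ≠ 0 := by
    rintro rfl
    exact hne fun z hz => by rw [hc₀ z hz, zero_mul]
  refine hh₀.const_mul hpair (c / c₀) fun z hz => ?_
  rw [hc z hz, hc₀ z hz]
  field_simp

end
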